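/- arXiv:2510.23499 — 7 statements merged into one kernel-verified Lean document; each statement's English description precedes it below -/
import Mathlib

section
/- Let k ≥ 1 be an integer, let v ∈ {0,1,2}, and let i₁, …, i_k be positive integers with sum i = i₁ + ⋯ + i_k. Set q = ⌊i/k⌋. Then ∏_{j=1}^{k} iⱼ!/(2iⱼ − v)! ≤ (q!/(2q − v)!)^{k − (i − kq)} · ((q+1)!/(2q + 2 − v)!)^{i − kq}. -/
open Nat

/-- If consecutive ratios of a sequence `f` on the positive integers are at least `r` up to index `q`
and at most `r` from index `q` on, then `f` lies below the geometric sequence through `f q` of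
ratio `r`. -/
lemma mul_pow_le_mul_pow_of_ratio {f : ℕ → ℝ} {r : ℝ} (hr : 0 ≤ r) {q : ℕ} (hq : 1 ≤ q)
    (hle : ∀ n, 1 ≤ n → n ≤ q → r * f n ≤ f (n + 1))
    (hge : ∀ n, q ≤ n → f (n + 1) ≤ r * f n) {n : ℕ} (hn : 1 ≤ n) :
    f n * r ^ q ≤ f q * r ^ n := by
  rcases le_total q n with h | h
  · induction n, h using Nat.le_induction with
    | base => exact le_rfl
    | succ m hm ih =>
      calc f (m + 1) * r ^ q ≤ r * f m * r ^ q := by gcongr; exact hge m hm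
        _ = r * (f m * r ^ q) := by ring
        _ ≤ r * (f q * r ^ m) := mul_le_mul_of_nonneg_left (ih (hq.trans hm)) hr
        _ = f q * r ^ (m + 1) := by ring
  · induction h using Nat.decreasingInduction with
    | self => exact le_rfl
    | of_succ m hm ih =>
      rcases hr.eq_or_lt with rfl | hr'
      · simp [show q ≠ 0 by omega, show m ≠ 0 by omega]
      · refine le_of_mul_le_mul_left ?_ hr'
        calc r * (f m * r ^ q) = r * f m * r ^ q := by ring
          _ ≤ f (m + 1) * r ^ q := by gcongr; exact hle m hn hm.le
          _ ≤ f q * r ^ (m + 1) := ih (by omega)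
          _ = r * (f q * r ^ m) := by ring

/-- A sequence of positive reals that is log-concave on the positive integers, with `ρ n` the ratio
of consecutive terms, has its products over a fixed sum of indices maximized by balanced indices. -/
lemma prod_le_balanced_of_antitone_ratio {f ρ : ℕ → ℝ} (hf : ∀ n, 0 < f n)
    (hρ : ∀ n, 1 ≤ n → 0 < ρ n) (hfρ : ∀ n, 1 ≤ n → f (n + 1) = ρ n * f n)
    (hanti : ∀ m n, 1 ≤ m → m ≤ n → ρ n ≤ ρ m)
    {k : ℕ} (hk : 1 ≤ k) (a : Fin k → ℕ) (ha : ∀ j, 1 ≤ a j) :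
    ∏ j, f (a j) ≤ f ((∑ j, a j) / k) ^ (k - (∑ j, a j) % k) *
      f ((∑ j, a j) / k + 1) ^ ((∑ j, a j) % k) := by
  set i := ∑ j, a j with hi
  set q := i / k with hq_def
  have hki : k ≤ i := by
    simpa [hi] using Finset.sum_le_sum (s := Finset.univ) fun j _ => ha j
  have hq : 1 ≤ q := (Nat.one_le_div_iff hk).2 hki
  have hs : i % k < k := Nat.mod_lt _ hk
  have hr := hρ q hq
  refine le_of_mul_le_mul_right ?_ (pow_pos hr (q * k))
  calc (∏ j, f (a j)) * ρ q ^ (q * k) = ∏ j, f (a j) * ρ q ^ q := by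
        simp [Finset.prod_mul_distrib, pow_mul]
    _ ≤ ∏ j, f q * ρ q ^ a j := by
        refine Finset.prod_le_prod (fun j _ => by have := hf (a j); positivity) fun j _ => ?_
        refine mul_pow_le_mul_pow_of_ratio hr.le hq (fun n hn hnq => ?_) (fun n hqn => ?_) (ha j)
        · rw [hfρ n hn]
          exact mul_le_mul_of_nonneg_right (hanti n q hn hnq) (hf n).le
        · rw [hfρ n (hq.trans hqn)]
          exact mul_le_mul_of_nonneg_right (hanti q n hq hqn) (hf n).le
    _ = f q ^ k * ρ q ^ i := by
        simp [Finset.prod_mul_distrib, Finset.prod_pow_eq_pow_sum, hi]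
    _ = f q ^ (k - i % k + i % k) * ρ q ^ (i % k + q * k) := by
        rw [Nat.sub_add_cancel hs.le, hq_def, mul_comm (i / k), Nat.mod_add_div]
    _ = f q ^ (k - i % k) * f (q + 1) ^ (i % k) * ρ q ^ (q * k) := by
        rw [hfρ q hq]; ring

/-- Successive terms of `n ↦ n! / (2n - v)!`, for `v ≤ 2` and `n ≥ 1`. -/
lemma factorial_div_factorial_succ {v : ℕ} (hv : v ≤ 2) {n : ℕ} (hn : 1 ≤ n) :
    ((n + 1)! : ℝ) / ((2 * (n + 1) - v)! : ℝ) =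
      ((n : ℝ) + 1) / ((2 * n + 2 - v) * (2 * n + 1 - v)) * ((n ! : ℝ) / ((2 * n - v)! : ℝ)) := by
  obtain ⟨c, hc⟩ : ∃ c, 2 * n = c + v := ⟨2 * n - v, by omega⟩
  have hc' : (2 * n : ℝ) = c + v := by exact_mod_cast hc
  rw [show 2 * (n + 1) - v = c + 1 + 1 by omega, show 2 * n - v = c by omega, hc',
    Nat.factorial_succ n, Nat.factorial_succ (c + 1), Nat.factorial_succ c,
    show (c + v + 2 - v : ℝ) = c + 1 + 1 by ring, show (c + v + 1 - v : ℝ) = c + 1 by ring]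
  push_cast
  field_simp

/-- The ratios of successive terms of `n ↦ n! / (2n - v)!` decrease. -/
lemma factorial_ratio_antitone {v : ℕ} (hv : v ≤ 2) {m n : ℕ} (hm : 1 ≤ m) (hmn : m ≤ n) :
    ((n : ℝ) + 1) / ((2 * n + 2 - v) * (2 * n + 1 - v)) ≤
      ((m : ℝ) + 1) / ((2 * m + 2 - v) * (2 * m + 1 - v)) := by
  obtain ⟨e, rfl⟩ := Nat.exists_eq_add_of_le' hm
  obtain ⟨d, rfl⟩ := Nat.exists_eq_add_of_le hmn
  have he : (0 : ℝ) ≤ e := e.cast_nonneg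
  have hd : (0 : ℝ) ≤ d := d.cast_nonneg
  have hv' : (v : ℝ) ≤ 2 := by exact_mod_cast hv
  push_cast
  rw [div_le_div_iff₀ (mul_pos (by linarith) (by linarith)) (mul_pos (by linarith) (by linarith)),
    ← sub_nonneg]
  interval_cases v <;> push_cast <;> ring_nf <;> positivity

/-- Balanced product lemma: for positive integers `i₁,…,i_k` with sum `i` and `q = ⌊i/k⌋`,
`∏ⱼ iⱼ!/(2iⱼ-v)! ≤ (q!/(2q-v)!)^(k-(i-kq)) * ((q+1)!/(2q+2-v)!)^(i-kq)`. -/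
theorem balanced_product_lemma (k : ℕ) (hk : 1 ≤ k) (v : ℕ) (hv : v ≤ 2)
    (a : Fin k → ℕ) (ha : ∀ j, 1 ≤ a j) (i : ℕ) (hi : i = ∑ j, a j) :
    (∏ j, ((a j)! : ℝ) / ((2 * a j - v)! : ℝ)) ≤
      (((i / k)! : ℝ) / ((2 * (i / k) - v)! : ℝ)) ^ (k - (i - k * (i / k))) *
        (((i / k + 1)! : ℝ) / ((2 * (i / k) + 2 - v)! : ℝ)) ^ (i - k * (i / k)) := by
  have hmod : i - k * (i / k) = i % k := by have := Nat.mod_add_div i k; omega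
  rw [hmod, hi]
  have hv' : (v : ℝ) ≤ 2 := by exact_mod_cast hv
  refine prod_le_balanced_of_antitone_ratio (f := fun n => (n ! : ℝ) / ((2 * n - v)! : ℝ))
    (ρ := fun n => ((n : ℝ) + 1) / ((2 * n + 2 - v) * (2 * n + 1 - v)))
    (fun n => by positivity) (fun n hn => ?_)
    (fun n hn => factorial_div_factorial_succ hv hn)
    (fun m n hm hmn => factorial_ratio_antitone hv hm hmn) hk a ha
  have hn' : (1 : ℝ) ≤ n := by exact_mod_cast hn
  exact div_pos (by linarith) (mul_pos (by linarith) (by linarith))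
end

section
/- There exists a universal constant C > 0 such that for every integer k ≥ 1, every v ∈ {0,1,2}, and all positive integers i₁, …, i_k with sum i = i₁ + ⋯ + i_k, one has ∏_{j=1}^{k} iⱼ!/(2iⱼ − v)! ≤ C^i · k^i / i!. -/
open Nat

/-- A multinomial coefficient over an index set of size `k` is at most `k ^ n`. -/
theorem factorial_sum_le_card_pow_mul_prod_factorial {ι : Type*} [Fintype ι] (a : ι → ℕ) :
    (∑ j, a j)! ≤ Fintype.card ι ^ (∑ j, a j) * ∏ j, (a j)! := by
  classical
  have hm : Nat.multinomial Finset.univ a ≤ Fintype.card ι ^ (∑ j, a j) := by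
    have h := Finset.sum_pow_eq_sum_piAntidiag (Finset.univ : Finset ι) (fun _ => (1 : ℕ))
      (∑ j, a j)
    simp only [Finset.sum_const, smul_eq_mul, mul_one, one_pow, Finset.prod_const_one,
      Finset.card_univ, Nat.cast_id] at h
    rw [h]
    exact Finset.single_le_sum (f := fun b => Nat.multinomial Finset.univ b)
      (fun _ _ => Nat.zero_le _) (by simp)
  rw [← Nat.multinomial_spec Finset.univ a, mul_comm]
  exact Nat.mul_le_mul_right _ hm

theorem factorial_sq_le_four_pow_mul_factorial {v n : ℕ} (hv : v ≤ 2) (hn : 1 ≤ n) :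
    n ! * n ! ≤ 4 ^ n * (2 * n - v)! := by
  obtain ⟨b, rfl⟩ := Nat.exists_eq_add_of_le' hn
  have hb : b ! * b ! ≤ (2 * (b + 1) - v)! :=
    (Nat.le_of_dvd (Nat.factorial_pos _) (Nat.factorial_mul_factorial_dvd_factorial_add b b)).trans
      (Nat.factorial_le (by omega))
  have hp : (b + 1) * (b + 1) ≤ 4 ^ (b + 1) := by
    have h : b + 1 ≤ 2 ^ (b + 1) := Nat.lt_two_pow_self.le
    calc (b + 1) * (b + 1) ≤ 2 ^ (b + 1) * 2 ^ (b + 1) := Nat.mul_le_mul h h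
      _ = 4 ^ (b + 1) := by rw [← mul_pow]; norm_num
  calc (b + 1)! * (b + 1)! = (b + 1) * (b + 1) * (b ! * b !) := by
        rw [Nat.factorial_succ]; ring
    _ ≤ _ := Nat.mul_le_mul hp hb

/-- Uniform product estimate: there is a universal constant `C > 0` such that for all
positive integers `i₁,…,i_k` with sum `i` and `v ∈ {0,1,2}`,
`∏ⱼ iⱼ!/(2iⱼ-v)! ≤ C^i · k^i / i!`. -/
theorem prod_factorial_estimate :
    ∃ C : ℝ, 0 < C ∧
      ∀ k : ℕ, 1 ≤ k → ∀ v : ℕ, v ≤ 2 → ∀ a : Fin k → ℕ, (∀ j, 1 ≤ a j) →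
        (∏ j, ((a j)! : ℝ) / ((2 * a j - v)! : ℝ)) ≤
          C ^ (∑ j, a j) * (k : ℝ) ^ (∑ j, a j) / ((∑ j, a j)! : ℝ) := by
  refine ⟨4, by norm_num, fun k _ v hv a ha => ?_⟩
  have hfac : ∀ j, ((a j)! : ℝ) / ((2 * a j - v)! : ℝ) ≤ 4 ^ a j / ((a j)! : ℝ) := fun j => by
    rw [div_le_div_iff₀ (by positivity) (by positivity)]
    exact_mod_cast factorial_sq_le_four_pow_mul_factorial hv (ha j)
  have hmul : ((∑ j, a j)! : ℝ) ≤ (k : ℝ) ^ (∑ j, a j) * ∏ j, ((a j)! : ℝ) := by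
    have h := factorial_sum_le_card_pow_mul_prod_factorial a
    rw [Fintype.card_fin] at h
    exact_mod_cast h
  calc (∏ j, ((a j)! : ℝ) / ((2 * a j - v)! : ℝ))
      ≤ ∏ j, (4 ^ a j / ((a j)! : ℝ)) :=
        Finset.prod_le_prod (fun _ _ => by positivity) (fun j _ => hfac j)
    _ = 4 ^ (∑ j, a j) / ∏ j, ((a j)! : ℝ) := by
        rw [Finset.prod_div_distrib, Finset.prod_pow_eq_pow_sum]
    _ ≤ _ := by
        rw [div_le_div_iff₀ (Finset.prod_pos fun _ _ => by positivity) (by positivity), mul_assoc]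
        gcongr
end

section
/- Let ε ∈ (0,1], let f be a smooth real-valued function on an open interval I ⊂ ℝ, let t ∈ I, and let g ≥ 0 be a real number. Suppose f(t) < 0 and |f^{(i)}(t)| ≤ i!·g^i·|f(t)| for every integer i ≥ 1. Then for every integer i ≥ 1, |(e^f)^{(i)}(t)| ≤ i!·e^{(1−ε)f(t)}·(2g/ε)^i, where (e^f)^{(i)} denotes the i-th derivative of the composition t ↦ exp(f(t)). -/
open Nat

open Finset in
/-- A Grönwall-type bound on the coefficients of a power series `S` satisfying
`S' ≤ L / (1 - x) ^ 2 * S` coefficientwise. -/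
theorem coeff_mul_pow_le_exp {a : ℕ → ℝ} {L r : ℝ} (ha : ∀ n, 0 ≤ a n) (ha0 : a 0 ≤ 1)
    (hL : 0 ≤ L)
    (hrec : ∀ n : ℕ, (n + 1) * a (n + 1) ≤ L * ∑ k ∈ range (n + 1), (k + 1) * a (n - k))
    (hr0 : 0 ≤ r) (hr1 : r < 1) (n : ℕ) :
    a n * r ^ n ≤ Real.exp (L * (r / (1 - r))) := by
  set S : ℝ → ℝ := fun x => ∑ m ∈ range (n + 1), a m * x ^ m with hS
  set S' : ℝ → ℝ := fun x => ∑ m ∈ range n, (m + 1) * a (m + 1) * x ^ m with hS'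
  have hderiv (x : ℝ) : HasDerivAt S (S' x) x := by
    have h : HasDerivAt S (∑ m ∈ range (n + 1), a m * (m * x ^ (m - 1))) x :=
      HasDerivAt.fun_sum fun m _ => (hasDerivAt_pow m x).const_mul (a m)
    convert h using 1
    rw [sum_range_succ']
    simp only [hS', Nat.add_sub_cancel, Nat.cast_add, Nat.cast_one, Nat.cast_zero, zero_mul,
      mul_zero, add_zero]
    exact sum_congr rfl fun m _ => by ring
  have hgeom {x : ℝ} (hx0 : 0 ≤ x) (hx1 : x < 1) :
      ∑ k ∈ range n, (k + 1) * x ^ k ≤ 1 / (1 - x) ^ 2 := by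
    have key (N : ℕ) : (∑ k ∈ range N, ((k : ℝ) + 1) * x ^ k) * (1 - x) ^ 2 =
        1 - x ^ N * (1 + N * (1 - x)) := by
      induction N with
      | zero => simp
      | succ N ih => rw [sum_range_succ, add_mul, ih]; push_cast; ring
    have h1 : 0 < 1 - x := sub_pos.2 hx1
    rw [le_div_iff₀ (by positivity), key]
    have : 0 ≤ x ^ n * (1 + n * (1 - x)) := by positivity
    linarith
  have hS'le {x : ℝ} (hx0 : 0 ≤ x) (hx1 : x < 1) : S' x ≤ L * (1 / (1 - x) ^ 2) * S x := by
    have hpos (m : ℕ) : 0 ≤ a m * x ^ m := mul_nonneg (ha m) (pow_nonneg hx0 m)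
    calc S' x ≤ ∑ m ∈ range n, L * ∑ k ∈ range (m + 1),
          ((k + 1) * x ^ k) * (a (m - k) * x ^ (m - k)) := by
          refine sum_le_sum fun m _ => ?_
          refine (mul_le_mul_of_nonneg_right (hrec m) (pow_nonneg hx0 m)).trans_eq ?_
          rw [mul_assoc, sum_mul]
          congr 1
          refine sum_congr rfl fun k hk => ?_
          rw [← pow_mul_pow_sub x (mem_range_succ_iff.1 hk)]
          ring
      _ = L * ∑ k ∈ range n, ((k + 1) * x ^ k) * ∑ l ∈ range (n - k), a l * x ^ l := by
          rw [← mul_sum, sum_range_diag_flip n fun k l => ((k + 1 : ℝ) * x ^ k) * (a l * x ^ l)]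
          simp only [mul_sum]
      _ ≤ L * ∑ k ∈ range n, ((k + 1) * x ^ k) * S x := by
          gcongr with k _
          exact sum_le_sum_of_subset_of_nonneg (range_mono (by lia)) fun m _ _ => hpos m
      _ ≤ L * (1 / (1 - x) ^ 2) * S x := by
          rw [← sum_mul, ← mul_assoc]
          gcongr
          · exact sum_nonneg fun m _ => hpos m
          · exact hgeom hx0 hx1
  have hexp {x : ℝ} (hx1 : x < 1) : HasDerivAt (fun y => S y * Real.exp (-(L * (y / (1 - y)))))
      ((S' x - L * (1 / (1 - x) ^ 2) * S x) * Real.exp (-(L * (x / (1 - x))))) x := by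
    have h1 : 1 - x ≠ 0 := (sub_pos.2 hx1).ne'
    have h := (((hasDerivAt_id x).div ((hasDerivAt_id x).const_sub 1) h1).const_mul L).neg.exp
    refine ((hderiv x).mul h).congr_deriv ?_
    simp only [id, Pi.div_apply, Pi.neg_apply]
    field_simp
    ring
  have hanti : AntitoneOn (fun y => S y * Real.exp (-(L * (y / (1 - y))))) (Set.Icc 0 r) := by
    refine antitoneOn_of_deriv_nonpos (convex_Icc 0 r)
      (fun x hx => (hexp (hx.2.trans_lt hr1)).continuousAt.continuousWithinAt)
      (fun x hx => ?_) (fun x hx => ?_) <;> rw [interior_Icc] at hx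
    · exact (hexp (hx.2.trans hr1)).differentiableAt.differentiableWithinAt
    · rw [(hexp (hx.2.trans hr1)).deriv]
      exact mul_nonpos_of_nonpos_of_nonneg
        (sub_nonpos.2 (hS'le hx.1.le (hx.2.trans hr1))) (Real.exp_pos _).le
  have hend := hanti (Set.left_mem_Icc.2 hr0) (Set.right_mem_Icc.2 hr0) hr0
  have hS0 : S 0 = a 0 := by simp [hS, sum_range_succ']
  simp only [hS0, zero_div, mul_zero, neg_zero, Real.exp_zero, mul_one, Real.exp_neg] at hend
  rw [← div_eq_mul_inv, div_le_iff₀ (Real.exp_pos _)] at hend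
  calc a n * r ^ n ≤ S r := single_le_sum (f := fun m => a m * r ^ m)
        (fun m _ => mul_nonneg (ha m) (pow_nonneg hr0 m)) (self_mem_range_succ n)
    _ ≤ a 0 * Real.exp (L * (r / (1 - r))) := hend
    _ ≤ Real.exp (L * (r / (1 - r))) := mul_le_of_le_one_left (Real.exp_pos _).le ha0

/-- Leibniz rule applied to `(e ^ f)' = f' * e ^ f`. -/
theorem abs_iteratedDerivWithin_succ_exp_comp_le {f : ℝ → ℝ} {s : Set ℝ} (hs : UniqueDiffOn ℝ s)
    (hf : ContDiffOn ℝ (⊤ : ℕ∞) f s) {t : ℝ} (ht : t ∈ s) (n : ℕ) :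
    |iteratedDerivWithin (n + 1) (fun x => Real.exp (f x)) s t| ≤
      ∑ k ∈ Finset.range (n + 1), (n.choose k : ℝ) * |iteratedDerivWithin (k + 1) f s t| *
        |iteratedDerivWithin (n - k) (fun x => Real.exp (f x)) s t| := by
  have hEq : Set.EqOn (derivWithin (fun x => Real.exp (f x)) s)
      (fun x => derivWithin f s x * Real.exp (f x)) s := fun x hx => by
    rw [derivWithin_exp (hf.differentiableOn (by simp) x hx) (hs x hx), mul_comm]
  rw [iteratedDerivWithin_succ', iteratedDerivWithin_congr hEq ht]
  have h := norm_iteratedFDerivWithin_mul_le (N := ((⊤ : ℕ∞) : WithTop ℕ∞)) (n := n)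
    (hf.derivWithin hs (by simp)) hf.exp hs ht (by exact_mod_cast le_top)
  simpa only [norm_iteratedFDerivWithin_eq_norm_iteratedDerivWithin, Real.norm_eq_abs,
    iteratedDerivWithin_succ'] using h

/-- Derivative bounds for `exp ∘ f`: if `f(t) < 0` and `|f⁽ⁱ⁾(t)| ≤ i!·gⁱ·|f(t)|` for all
`i ≥ 1`, then `|(e^f)⁽ⁱ⁾(t)| ≤ i!·e^{(1-ε)f(t)}·(2g/ε)ⁱ` for all `i ≥ 1`. -/
theorem exp_comp_deriv_bound (ε : ℝ) (hε : 0 < ε) (hε1 : ε ≤ 1)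
    (a b : ℝ) (f : ℝ → ℝ) (hf : ContDiffOn ℝ (⊤ : ℕ∞) f (Set.Ioo a b))
    (t : ℝ) (ht : t ∈ Set.Ioo a b) (g : ℝ) (hg : 0 ≤ g)
    (hft : f t < 0)
    (hd : ∀ i : ℕ, 1 ≤ i →
      |iteratedDerivWithin i f (Set.Ioo a b) t| ≤ (i ! : ℝ) * g ^ i * |f t|) :
    ∀ i : ℕ, 1 ≤ i →
      |iteratedDerivWithin i (fun x => Real.exp (f x)) (Set.Ioo a b) t| ≤
        (i ! : ℝ) * Real.exp ((1 - ε) * f t) * (2 * g / ε) ^ i := by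
  intro i hi
  have hstep (n : ℕ) := abs_iteratedDerivWithin_succ_exp_comp_le isOpen_Ioo.uniqueDiffOn hf ht n
  set D : ℕ → ℝ := fun n => |iteratedDerivWithin n (fun x => Real.exp (f x)) (Set.Ioo a b) t|
    with hD
  have hD0 : D 0 = Real.exp (f t) := by simp [hD]
  have hDstep (n : ℕ) : D (n + 1) ≤ ∑ k ∈ Finset.range (n + 1),
      (n.choose k : ℝ) * (((k + 1)! : ℝ) * g ^ (k + 1) * |f t|) * D (n - k) := by
    refine (hstep n).trans (Finset.sum_le_sum fun k _ => ?_)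
    gcongr
    exact hd (k + 1) (by lia)
  change D i ≤ _
  rcases hg.eq_or_lt with rfl | hg
  · obtain ⟨n, rfl⟩ : ∃ n, i = n + 1 := ⟨i - 1, by lia⟩
    simpa using hDstep n
  have hrec (n : ℕ) : ((n : ℝ) + 1) * (D (n + 1) / ((n + 1)! * g ^ (n + 1) * Real.exp (f t))) ≤
      |f t| * ∑ k ∈ Finset.range (n + 1),
        ((k : ℝ) + 1) * (D (n - k) / ((n - k)! * g ^ (n - k) * Real.exp (f t))) := by
    have hfac : ((n : ℝ) + 1) * (D (n + 1) / ((n + 1)! * g ^ (n + 1) * Real.exp (f t))) =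
        D (n + 1) / (n ! * g ^ (n + 1) * Real.exp (f t)) := by
      rw [Nat.factorial_succ]
      push_cast
      field_simp
    rw [hfac, div_le_iff₀ (by positivity)]
    refine (hDstep n).trans_eq ?_
    rw [mul_assoc, Finset.sum_mul, Finset.mul_sum]
    refine Finset.sum_congr rfl fun k hk => ?_
    have hkn := Finset.mem_range_succ_iff.1 hk
    rw [Nat.cast_choose ℝ hkn, Nat.factorial_succ k, ← pow_mul_pow_sub g (Nat.succ_le_succ hkn),
      Nat.succ_sub_succ]
    push_cast
    field_simp
  have hbound := coeff_mul_pow_le_exp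
    (a := fun n => D n / (n ! * g ^ n * Real.exp (f t))) (r := ε / 2)
    (fun n => by have := abs_nonneg (iteratedDerivWithin n (fun x => Real.exp (f x))
                  (Set.Ioo a b) t); positivity)
    (by simp [hD0]) (abs_nonneg (f t)) hrec (by positivity) (by linarith) i
  have hr : ε / 2 / (1 - ε / 2) ≤ ε := by
    rw [div_le_iff₀ (by linarith)]
    nlinarith
  have hfinal := hbound.trans (Real.exp_le_exp.2 (mul_le_mul_of_nonneg_left hr (abs_nonneg (f t))))
  rw [div_mul_eq_mul_div, div_le_iff₀ (by positivity), ← le_div_iff₀ (by positivity)] at hfinal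
  refine hfinal.trans_eq ?_
  rw [show (1 - ε) * f t = |f t| * ε + f t by rw [abs_of_neg hft]; ring, Real.exp_add, div_pow,
    div_pow, mul_pow]
  field_simp
end

section
/- Let ε > 0, let f be a smooth real-valued function on an open interval I ⊂ ℝ, let t ∈ I with 0 < |f(t)| ≤ 1, and let g ≥ 0 be a real number. Suppose |f^{(i)}(t)| ≤ i!·g^i·|f(t)|^{1−ε} for every integer i ≥ 1. Then for every integer i ≥ 1, |(1/f)^{(i)}(t)| ≤ i!·(4g)^i·(1/|f(t)|)^{1+iε}, where (1/f)^{(i)} denotes the i-th derivative of the function t ↦ 1/f(t). -/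
open Nat

/-- Leibniz recursion for the derivatives of `1/f`, from `(1/f) * f = 1`. -/
lemma iteratedDeriv_inv_mul_eq_neg_sum {f : ℝ → ℝ} {t : ℝ}
    (hf : ContDiffAt ℝ (⊤ : ℕ∞) f t) (hft : f t ≠ 0) {n : ℕ} (hn : n ≠ 0) :
    iteratedDeriv n (fun x => 1 / f x) t * f t =
      -∑ k ∈ Finset.range n, (n.choose k : ℝ) * iteratedDeriv k (fun x => 1 / f x) t *
        iteratedDeriv (n - k) f t := by
  have hfn : ContDiffAt ℝ n f t := hf.of_le (by exact_mod_cast le_top)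
  have hinv : ContDiffAt ℝ n (fun x => 1 / f x) t := contDiffAt_const.div hfn hft
  have hone : (fun x => 1 / f x) * f =ᶠ[nhds t] fun _ => (1 : ℝ) := by
    filter_upwards [hf.continuousAt.eventually_ne hft] with x hx
    simp [hx]
  have hmul := iteratedDeriv_mul hinv hfn
  rw [hone.iteratedDeriv_eq, iteratedDeriv_const, if_neg hn, Finset.sum_range_succ] at hmul
  simp only [choose_self, cast_one, one_mul, Nat.sub_self, iteratedDeriv_zero] at hmul
  linarith

/-- If `|f⁽ʲ⁾(t)| ≤ j!·gʲ·u·|f(t)|` for all `j ≥ 1`, with `u ≥ 1`, then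
`|(1/f)⁽ⁿ⁾(t)| ≤ n!·(4g)ⁿ·uⁿ/|f(t)|`. -/
lemma abs_iteratedDeriv_inv_le {f : ℝ → ℝ} {t g u : ℝ}
    (hf : ContDiffAt ℝ (⊤ : ℕ∞) f t) (hft : f t ≠ 0) (hg : 0 ≤ g) (hu : 1 ≤ u)
    (hd : ∀ j : ℕ, 1 ≤ j → |iteratedDeriv j f t| ≤ (j ! : ℝ) * g ^ j * (u * |f t|)) (n : ℕ) :
    |iteratedDeriv n (fun x => 1 / f x) t| ≤ (n ! : ℝ) * (4 * g) ^ n * (u ^ n / |f t|) := by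
  have hpos : 0 < |f t| := abs_pos.mpr hft
  induction n using Nat.strong_induction_on with
  | _ n ih =>
    rcases eq_or_ne n 0 with rfl | hn
    · simp
    have hterm : ∀ k ∈ Finset.range n,
        |(n.choose k : ℝ) * iteratedDeriv k (fun x => 1 / f x) t * iteratedDeriv (n - k) f t| ≤
          4 ^ k * ((n ! : ℝ) * g ^ n * u ^ n) := by
      intro k hk
      have hkn : k < n := Finset.mem_range.mp hk
      calc _ = (n.choose k : ℝ) * |iteratedDeriv k (fun x => 1 / f x) t| *
              |iteratedDeriv (n - k) f t| := by simp [abs_mul]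
        _ ≤ (n.choose k : ℝ) * ((k ! : ℝ) * (4 * g) ^ k * (u ^ k / |f t|)) *
              (((n - k) ! : ℝ) * g ^ (n - k) * (u * |f t|)) := by
            gcongr
            · exact ih k hkn
            · exact hd _ (by lia)
        _ = 4 ^ k * (((n.choose k * k ! * (n - k) ! : ℕ) : ℝ) * (g ^ k * g ^ (n - k)) *
              u ^ (k + 1)) := by
            push_cast
            field_simp
            ring
        _ ≤ 4 ^ k * ((n ! : ℝ) * g ^ n * u ^ n) := by
            rw [choose_mul_factorial_mul_factorial hkn.le, ← pow_add, Nat.add_sub_cancel' hkn.le]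
            gcongr
            exact hkn
    have hgeom : ∑ k ∈ Finset.range n, (4 : ℝ) ^ k ≤ 4 ^ n := by
      rw [geom_sum_eq (by norm_num)]
      linarith [one_le_pow₀ (n := n) (by norm_num : (1 : ℝ) ≤ 4)]
    rw [← mul_div_assoc, le_div_iff₀ hpos, ← abs_mul,
      iteratedDeriv_inv_mul_eq_neg_sum hf hft hn, abs_neg]
    calc _ ≤ ∑ k ∈ Finset.range n, (4 : ℝ) ^ k * ((n ! : ℝ) * g ^ n * u ^ n) :=
          (Finset.abs_sum_le_sum_abs _ _).trans (Finset.sum_le_sum hterm)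
      _ ≤ 4 ^ n * ((n ! : ℝ) * g ^ n * u ^ n) := by
          rw [← Finset.sum_mul]
          gcongr
      _ = (n ! : ℝ) * (4 * g) ^ n * u ^ n := by ring

/-- Derivative bounds for `1/f`: if `0 < |f(t)| ≤ 1` and `|f⁽ⁱ⁾(t)| ≤ i!·gⁱ·|f(t)|^{1-ε}`
for all `i ≥ 1`, then `|(1/f)⁽ⁱ⁾(t)| ≤ i!·(4g)ⁱ·(1/|f(t)|)^{1+iε}` for all `i ≥ 1`. -/
theorem inv_comp_deriv_bound (ε : ℝ) (hε : 0 < ε)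
    (a b : ℝ) (f : ℝ → ℝ) (hf : ContDiffOn ℝ (⊤ : ℕ∞) f (Set.Ioo a b))
    (t : ℝ) (ht : t ∈ Set.Ioo a b) (hft0 : 0 < |f t|) (hft1 : |f t| ≤ 1)
    (g : ℝ) (hg : 0 ≤ g)
    (hd : ∀ i : ℕ, 1 ≤ i →
      |iteratedDerivWithin i f (Set.Ioo a b) t| ≤ (i ! : ℝ) * g ^ i * |f t| ^ ((1 : ℝ) - ε)) :
    ∀ i : ℕ, 1 ≤ i →
      |iteratedDerivWithin i (fun x => 1 / f x) (Set.Ioo a b) t| ≤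
        (i ! : ℝ) * (4 * g) ^ i * (1 / |f t|) ^ ((1 : ℝ) + (i : ℝ) * ε) := by
  intro i _
  have hfa : ContDiffAt ℝ (⊤ : ℕ∞) f t := hf.contDiffAt (isOpen_Ioo.mem_nhds ht)
  simp only [iteratedDerivWithin_of_isOpen isOpen_Ioo ht] at hd ⊢
  have hu : 1 ≤ |f t| ^ (-ε) :=
    Real.one_le_rpow_of_pos_of_le_one_of_nonpos hft0 hft1 (by linarith)
  have hsplit : |f t| ^ (1 - ε) = |f t| ^ (-ε) * |f t| := by
    rw [sub_eq_neg_add, Real.rpow_add_one hft0.ne']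
  have hpow : (1 / |f t|) ^ (1 + (i : ℝ) * ε) = (|f t| ^ (-ε)) ^ i / |f t| := by
    rw [one_div, Real.inv_rpow hft0.le, ← Real.rpow_neg hft0.le, ← Real.rpow_mul_natCast hft0.le,
      ← Real.rpow_sub_one hft0.ne']
    ring_nf
  rw [hsplit] at hd
  rw [hpow]
  exact abs_iteratedDeriv_inv_le hfa (abs_pos.mp hft0) hg hu hd i
end

section
/- Let ε ∈ (0,1]. For t ∈ (0,1], define recursively f₀(t) = t², f_{k+1}(t) = e^{−1/f_k(t)} for k ≥ 0, and g₀(t) = 2/t, g_{k+1}(t) = (8/(ε·f_k(t)^ε))·g_k(t) for k ≥ 0. Then for every integer k ≥ 0, every integer i ≥ 1, and every t ∈ (0,1], one has |f_k^{(i)}(t)| ≤ i!·g_k(t)^i·f_k(t)^{1−ε}. -/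
open Nat

/-- `f₀(t) = t²`, `f_{k+1}(t) = e^{-1/f_k(t)}`. -/
noncomputable def fIter : ℕ → ℝ → ℝ
  | 0 => fun t => t ^ 2
  | (k + 1) => fun t => Real.exp (-1 / fIter k t)

/-- `g₀(t) = 2/t`, `g_{k+1}(t) = (8/(ε·f_k(t)^ε))·g_k(t)`. -/
noncomputable def gIter (ε : ℝ) : ℕ → ℝ → ℝ
  | 0 => fun t => 2 / t
  | (k + 1) => fun t => 8 / (ε * fIter k t ^ ε) * gIter ε k t

open Metric Set in
/-- On a disc shrunk by the factor `ε * y ^ ε / 8`, the Schwarz lemma keeps a holomorphic `F`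
within `ε / 4 * y` of its central value `y`. -/
lemma dist_le_of_mapsTo_closedBall_rpow {F : ℂ → ℂ} {c : ℂ} {y ε G : ℝ} (hε : 0 < ε)
    (hε1 : ε ≤ 1) (hy : 0 < y) (hy1 : y ≤ 1) (hG : 0 < G) (hFc : F c = y)
    (hd : DifferentiableOn ℂ F (ball c (1 / G)))
    (hb : MapsTo F (ball c (1 / G)) (closedBall (y : ℂ) (2 * y ^ (1 - ε))))
    {z : ℂ} (hz : z ∈ closedBall c (1 / (8 / (ε * y ^ ε) * G))) :
    z ∈ ball c (1 / G) ∧ dist (F z) y ≤ ε / 4 * y := by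
  have hp : 0 < y ^ ε := Real.rpow_pos_of_pos hy ε
  have hp1 : y ^ ε ≤ 1 := Real.rpow_le_one hy.le hy1 hε.le
  have hr : 1 / (8 / (ε * y ^ ε) * G) = ε * y ^ ε / 8 * (1 / G) := by field_simp
  have hz' : dist z c ≤ ε * y ^ ε / 8 * (1 / G) := by rw [← hr]; exact hz
  have hG' : 0 < 1 / G := by positivity
  have hzb : z ∈ ball c (1 / G) := by
    refine mem_ball.2 (hz'.trans_lt ?_)
    have : ε * y ^ ε ≤ 1 := mul_le_one₀ hε1 hp.le hp1
    nlinarith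
  refine ⟨hzb, ?_⟩
  rw [← hFc] at hb ⊢
  refine (Complex.dist_le_div_mul_dist_of_mapsTo_ball hd hb hzb).trans ?_
  have hq : 0 < y ^ (1 - ε) := Real.rpow_pos_of_pos hy _
  have hpq : y ^ (1 - ε) * y ^ ε = y := by
    rw [← Real.rpow_add hy]; simp
  calc 2 * y ^ (1 - ε) / (1 / G) * dist z c
      ≤ 2 * y ^ (1 - ε) / (1 / G) * (ε * y ^ ε / 8 * (1 / G)) := by gcongr
    _ = ε / 4 * (y ^ (1 - ε) * y ^ ε) := by field_simp; ring
    _ = ε / 4 * y := by rw [hpq]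

lemma norm_exp_neg_one_div_le_of_dist_le {w : ℂ} {y ε : ℝ} (hε : 0 < ε) (hε1 : ε ≤ 1)
    (hy : 0 < y) (hw : dist w y ≤ ε / 4 * y) :
    w ≠ 0 ∧ ‖Complex.exp (-1 / w)‖ ≤ Real.exp (-1 / y) ^ (1 - ε) := by
  have hwn : 3 / 4 * y ≤ ‖w‖ := by
    have h := norm_sub_norm_le (y : ℂ) w
    rw [← dist_eq_norm, _root_.dist_comm, Complex.norm_of_nonneg hy.le] at h
    nlinarith
  have hwpos : 0 < ‖w‖ := by linarith
  have hw0 : w ≠ 0 := norm_pos_iff.1 hwpos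
  have hyc : (y : ℂ) ≠ 0 := Complex.ofReal_ne_zero.2 hy.ne'
  refine ⟨hw0, ?_⟩
  rw [Complex.norm_exp, ← Real.exp_mul, Real.exp_le_exp]
  have hsub : -1 / w - ((-1 / y : ℝ) : ℂ) = (w - y) / (y * w) := by
    push_cast
    field_simp
    ring
  have hdiff : ‖-1 / w - ((-1 / y : ℝ) : ℂ)‖ ≤ ε / y := by
    rw [hsub, norm_div, norm_mul, Complex.norm_of_nonneg hy.le, ← dist_eq_norm,
      div_le_div_iff₀ (by positivity) hy]
    have h1 : dist w y * y ≤ ε / 4 * y * y := by gcongr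
    have h2 : ε * (y * (3 / 4 * y)) ≤ ε * (y * ‖w‖) := by gcongr
    have h3 : 0 < ε * y * y := by positivity
    linarith
  have h := (Complex.re_le_norm _).trans hdiff
  rw [Complex.sub_re, Complex.ofReal_re] at h
  have : -1 / y * (1 - ε) = -1 / y + ε / y := by ring
  linarith

lemma iteratedDeriv_eq_re_of_analyticAt {F : ℂ → ℂ} {f : ℝ → ℝ} (h : ∀ x : ℝ, f x = (F x).re)
    (i : ℕ) {x : ℝ} (hx : AnalyticAt ℂ F x) :
    iteratedDeriv i f x = (iteratedDeriv i F x).re := by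
  induction i generalizing x with
  | zero => simpa using h x
  | succ i ih =>
    have hev : ∀ᶠ u : ℝ in nhds x, iteratedDeriv i f u = (iteratedDeriv i F u).re := by
      have := Complex.continuous_ofReal.continuousAt.eventually hx.eventually_analyticAt
      filter_upwards [this] with u hu using ih hu
    have hdiff : DifferentiableAt ℂ (iteratedDeriv i F) x := by
      rw [iteratedDeriv_eq_iterate]
      exact (hx.iterated_deriv i).differentiableAt
    rw [iteratedDeriv_succ, iteratedDeriv_succ, Filter.EventuallyEq.deriv_eq hev]
    exact hdiff.hasDerivAt.real_of_complex.deriv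

/-- The extension of `fIter` to the complex plane. -/
noncomputable def fIterComplex : ℕ → ℂ → ℂ
  | 0 => fun z => z ^ 2
  | (k + 1) => fun z => Complex.exp (-1 / fIterComplex k z)

lemma fIterComplex_ofReal (k : ℕ) (x : ℝ) : fIterComplex k x = (fIter k x : ℂ) := by
  induction k with
  | zero => simp [fIterComplex, fIter]
  | succ k ih => simp [fIterComplex, fIter, ih]

lemma fIter_pos (k : ℕ) {t : ℝ} (ht : 0 < t) : 0 < fIter k t := by
  cases k with
  | zero => exact pow_pos ht 2
  | succ k => exact Real.exp_pos _

lemma fIter_le_one (k : ℕ) {t : ℝ} (ht : 0 < t) (ht1 : t ≤ 1) : fIter k t ≤ 1 := by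
  cases k with
  | zero => exact pow_le_one₀ ht.le ht1
  | succ k =>
    exact Real.exp_le_one_iff.2
      (div_nonpos_of_nonpos_of_nonneg (by norm_num) (fIter_pos k ht).le)

lemma gIter_pos {ε : ℝ} (hε : 0 < ε) (k : ℕ) {t : ℝ} (ht : 0 < t) : 0 < gIter ε k t := by
  induction k with
  | zero => exact div_pos two_pos ht
  | succ k ih =>
    have := Real.rpow_pos_of_pos (fIter_pos k ht) ε
    exact mul_pos (by positivity) ih

lemma fIter_le_rpow {ε : ℝ} (hε : 0 < ε) (k : ℕ) {t : ℝ} (ht : 0 < t) (ht1 : t ≤ 1) :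
    fIter k t ≤ fIter k t ^ (1 - ε) := by
  simpa using Real.rpow_le_rpow_of_exponent_ge (fIter_pos k ht) (fIter_le_one k ht ht1)
    (by linarith : 1 - ε ≤ 1)

open Metric Set in
/-- A disc around `t` on which `fIterComplex k` is holomorphic and controlled produces one
for `fIterComplex (k + 1)`. -/
lemma fIterComplex_succ_bound {ε : ℝ} (hε : 0 < ε) (hε1 : ε ≤ 1) {k : ℕ} {t : ℝ} (ht : 0 < t)
    (ht1 : t ≤ 1) (hd : DifferentiableOn ℂ (fIterComplex k) (ball t (1 / gIter ε k t)))
    (hb : MapsTo (fIterComplex k) (ball t (1 / gIter ε k t))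
      (closedBall (fIter k t : ℂ) (2 * fIter k t ^ (1 - ε))))
    {z : ℂ} (hz : z ∈ closedBall (t : ℂ) (1 / gIter ε (k + 1) t)) :
    DifferentiableAt ℂ (fIterComplex (k + 1)) z ∧
      ‖fIterComplex (k + 1) z‖ ≤ fIter (k + 1) t ^ (1 - ε) := by
  obtain ⟨hzb, hdist⟩ := dist_le_of_mapsTo_closedBall_rpow hε hε1 (fIter_pos k ht)
    (fIter_le_one k ht ht1) (gIter_pos hε k ht) (fIterComplex_ofReal k t) hd hb hz
  obtain ⟨hne, hnorm⟩ := norm_exp_neg_one_div_le_of_dist_le hε hε1 (fIter_pos k ht) hdist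
  have hdz : DifferentiableAt ℂ (fIterComplex k) z := hd.differentiableAt (isOpen_ball.mem_nhds hzb)
  exact ⟨((differentiableAt_const _).div hdz hne).cexp, hnorm⟩

open Metric Set in
lemma fIterComplex_bound {ε : ℝ} (hε : 0 < ε) (hε1 : ε ≤ 1) (k : ℕ) {t : ℝ} (ht : 0 < t)
    (ht1 : t ≤ 1) :
    DifferentiableOn ℂ (fIterComplex k) (ball t (1 / gIter ε k t)) ∧
      MapsTo (fIterComplex k) (ball t (1 / gIter ε k t))
        (closedBall (fIter k t : ℂ) (2 * fIter k t ^ (1 - ε))) := by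
  induction k with
  | zero =>
    refine ⟨(differentiable_pow 2).differentiableOn, fun z hz => ?_⟩
    have hz' : ‖z - t‖ < t / 2 := by
      rw [← dist_eq_norm]; simpa [gIter] using hz
    have hle : t ^ 2 ≤ fIter 0 t ^ (1 - ε) := fIter_le_rpow hε 0 ht ht1
    have hplus : ‖z + t‖ ≤ t / 2 + 2 * t := by
      calc ‖z + t‖ = ‖(z - t) + ((2 * t : ℝ) : ℂ)‖ := by congr 1; push_cast; ring
        _ ≤ ‖z - t‖ + ‖((2 * t : ℝ) : ℂ)‖ := norm_add_le _ _
        _ ≤ t / 2 + 2 * t := by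
          rw [Complex.norm_of_nonneg (by positivity)]
          linarith
    have hfac : z ^ 2 - ((t ^ 2 : ℝ) : ℂ) = (z - t) * (z + t) := by push_cast; ring
    have hmul : ‖z - t‖ * ‖z + t‖ ≤ t / 2 * (t / 2 + 2 * t) := by gcongr
    change dist (z ^ 2) ((t ^ 2 : ℝ) : ℂ) ≤ _
    rw [dist_eq_norm, hfac, norm_mul]
    nlinarith
  | succ k ih =>
    have key := fun z hz => fIterComplex_succ_bound hε hε1 ht ht1 ih.1 ih.2 (z := z)
      (ball_subset_closedBall hz)
    refine ⟨fun z hz => (key z hz).1.differentiableWithinAt, fun z hz => ?_⟩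
    have hle := fIter_le_rpow hε (k + 1) ht ht1
    rw [mem_closedBall, dist_eq_norm]
    refine (norm_sub_le _ _).trans ?_
    rw [Complex.norm_of_nonneg (fIter_pos (k + 1) ht).le]
    linarith [(key z hz).2]

lemma abs_iteratedDeriv_sq_le {ε : ℝ} (hε : 0 < ε) {i : ℕ} (hi : 1 ≤ i) {t : ℝ} (ht : 0 < t)
    (ht1 : t ≤ 1) :
    |iteratedDeriv i (fIter 0) t| ≤ (i ! : ℝ) * gIter ε 0 t ^ i * fIter 0 t ^ ((1 : ℝ) - ε) := by
  have hle : t ^ 2 ≤ fIter 0 t ^ (1 - ε) := fIter_le_rpow hε 0 ht ht1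
  have hg : 0 < gIter ε 0 t := gIter_pos hε 0 ht
  refine le_trans ?_ (mul_le_mul_of_nonneg_left hle (by positivity))
  change |iteratedDeriv i (· ^ 2) t| ≤ i ! * (2 / t) ^ i * t ^ 2
  rw [iteratedDeriv_pow]
  match i, hi with
  | 1, _ =>
    rw [abs_of_nonneg (by positivity)]
    apply le_of_eq
    simp
    field_simp
  | 2, _ =>
    rw [abs_of_nonneg (by positivity)]
    have : ((2 ! : ℕ) : ℝ) * (2 / t) ^ 2 * t ^ 2 = 8 := by
      simp [Nat.factorial]
      field_simp
      norm_num
    rw [this]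
    norm_num [Nat.descFactorial]
  | (n + 3), _ =>
    rw [Nat.descFactorial_of_lt (by omega)]
    simp only [Nat.cast_zero, zero_mul, abs_zero]
    positivity

/-- Derivative bounds for the iterated-exponential family: for all `k ≥ 0`, `i ≥ 1`
and `t ∈ (0,1]`, `|f_k⁽ⁱ⁾(t)| ≤ i!·g_k(t)ⁱ·f_k(t)^{1-ε}`. -/
theorem fIter_deriv_bound (ε : ℝ) (hε : 0 < ε) (hε1 : ε ≤ 1) :
    ∀ (k i : ℕ), 1 ≤ i → ∀ t : ℝ, 0 < t → t ≤ 1 →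
      |iteratedDeriv i (fIter k) t| ≤
        (i ! : ℝ) * gIter ε k t ^ i * fIter k t ^ ((1 : ℝ) - ε) := by
  intro k i hi t ht ht1
  cases k with
  | zero => exact abs_iteratedDeriv_sq_le hε hi ht ht1
  | succ k =>
    obtain ⟨hd, hb⟩ := fIterComplex_bound hε hε1 k ht ht1
    have key := fun z hz => fIterComplex_succ_bound hε hε1 ht ht1 hd hb (z := z) hz
    have hg := gIter_pos hε (k + 1) ht
    have hR : 0 < 1 / gIter ε (k + 1) t := by positivity
    have hdiff : DifferentiableOn ℂ (fIterComplex (k + 1))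
        (Metric.closedBall (t : ℂ) (1 / gIter ε (k + 1) t)) :=
      fun z hz => (key z hz).1.differentiableWithinAt
    have hcauchy := Complex.norm_iteratedDeriv_le_of_forall_mem_sphere_norm_le i hR
      (hdiff.diffContOnCl_ball subset_rfl)
      (fun z hz => (key z (Metric.sphere_subset_closedBall hz)).2)
    have han : AnalyticAt ℂ (fIterComplex (k + 1)) t :=
      hdiff.analyticAt (Metric.closedBall_mem_nhds _ hR)
    rw [iteratedDeriv_eq_re_of_analyticAt (fun x => by simp [fIterComplex_ofReal]) i han]
    refine (Complex.abs_re_le_norm _).trans (hcauchy.trans_eq ?_)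
    rw [one_div, inv_pow, div_inv_eq_mul]
    ring
end

section
/- There exist constants T ∈ (0,1], c > 0, δ > 0, and a smooth function u on the region Ω = {(x,t) ∈ ℝ × ℝ : 0 < t ≤ T, x² ≤ c/t} such that: (i) ∂_t u + ∂²_{xx} u = u² on Ω; (ii) u(0,t) = e^{−1/t²} for all t ∈ (0,T] (in particular u is not identically zero); (iii) |u(x,t)| ≤ e^{−δ/t²} for all (x,t) ∈ Ω (in particular u extends continuously by 0 to t = 0, vanishing there to infinite order). -/
/-- The coefficients `v₀ = g`, `(2 k + 2) (2 k + 1) v_{k+1} = - ∂ₜ v_k + ∑_{j ≤ k} v_j v_{k-j}` of the formal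
solution `∑ v_k(t) x ^ (2 k)` of `(∂ₜ + ∂ₓₓ)u = u²` with `u(0,t) = g(t)`. -/
noncomputable def quadHeatCoeff (g : ℝ → ℝ) : ℕ → ℝ → ℝ
  | 0 => g
  | k + 1 => fun t =>
      (-deriv (quadHeatCoeff g k) t +
        ∑ j : Fin (k + 1), quadHeatCoeff g j t * quadHeatCoeff g (k - j) t) /
        ((2 * k + 2) * (2 * k + 1))
termination_by k => k
decreasing_by all_goals omega

/-- The Taylor coefficients of the solution of `S' = (S + ε S²) / 2`, `S(0) = 1`. -/
noncomputable def bernoulliMajorant (ε : ℝ) : ℕ → ℝ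
  | 0 => 1
  | k + 1 =>
      (bernoulliMajorant ε k +
        ε * ∑ j : Fin (k + 1), bernoulliMajorant ε j * bernoulliMajorant ε (k - j)) /
        (2 * (k + 1))
termination_by k => k
decreasing_by all_goals omega

theorem quadHeatCoeff_zero (g : ℝ → ℝ) : quadHeatCoeff g 0 = g := by
  rw [quadHeatCoeff]

theorem quadHeatCoeff_succ (g : ℝ → ℝ) (k : ℕ) :
    quadHeatCoeff g (k + 1) = fun t =>
      ((2 * k + 2) * (2 * k + 1) : ℝ)⁻¹ * (-deriv (quadHeatCoeff g k) t +
        ∑ j ∈ Finset.range (k + 1), quadHeatCoeff g j t * quadHeatCoeff g (k - j) t) := by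
  funext t
  rw [quadHeatCoeff]
  simp only [Finset.sum_range, div_eq_inv_mul]

theorem bernoulliMajorant_zero (ε : ℝ) : bernoulliMajorant ε 0 = 1 := by
  rw [bernoulliMajorant]

theorem bernoulliMajorant_succ (ε : ℝ) (k : ℕ) :
    2 * (k + 1) * bernoulliMajorant ε (k + 1) = bernoulliMajorant ε k +
      ε * ∑ j ∈ Finset.range (k + 1), bernoulliMajorant ε j * bernoulliMajorant ε (k - j) := by
  rw [bernoulliMajorant, Finset.sum_range]
  field_simp

theorem bernoulliMajorant_nonneg {ε : ℝ} (hε : 0 ≤ ε) (k : ℕ) : 0 ≤ bernoulliMajorant ε k := by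
  induction k using Nat.strong_induction_on with
  | _ k ih =>
    cases k with
    | zero => simp [bernoulliMajorant_zero]
    | succ k =>
      have h := bernoulliMajorant_succ ε k
      have h1 : 0 ≤ ∑ j ∈ Finset.range (k + 1),
          bernoulliMajorant ε j * bernoulliMajorant ε (k - j) :=
        Finset.sum_nonneg fun j hj => mul_nonneg (ih j (Finset.mem_range.1 hj))
          (ih (k - j) (by omega))
      have h2 := ih k (by omega)
      have h3 : 0 ≤ 2 * ((k : ℝ) + 1) * bernoulliMajorant ε (k + 1) := by rw [h]; positivity
      exact nonneg_of_mul_nonneg_right h3 (by positivity)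

theorem sum_range_conv_le_sq {a : ℕ → ℝ} (ha : ∀ k, 0 ≤ a k) (N : ℕ) :
    ∑ k ∈ Finset.range N, ∑ j ∈ Finset.range (k + 1), a j * a (k - j) ≤
      (∑ k ∈ Finset.range N, a k) ^ 2 := by
  rw [Finset.sum_range_diag_flip N (fun i j => a i * a j), sq, Finset.sum_mul_sum]
  refine Finset.sum_le_sum fun i _ => Finset.sum_le_sum_of_subset_of_nonneg ?_ ?_
  · exact Finset.range_subset_range.2 (by omega)
  · exact fun j _ _ => mul_nonneg (ha i) (ha j)

theorem sum_bernoulliMajorant_le_exp {ε R : ℝ} (hε : 0 ≤ ε) (hR : ε * Real.exp R ≤ 1) (N : ℕ) :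
    ∀ s ∈ Set.Icc 0 R, ∑ k ∈ Finset.range N, bernoulliMajorant ε k * s ^ k ≤ Real.exp s := by
  induction N with
  | zero => intro s _; simpa using (Real.exp_pos s).le
  | succ N ih =>
    have hd : ∀ s, HasDerivAt
        (fun s : ℝ => ∑ k ∈ Finset.range (N + 1), bernoulliMajorant ε k * s ^ k)
        (∑ k ∈ Finset.range N, (k + 1) * bernoulliMajorant ε (k + 1) * s ^ k) s := by
      intro s
      have h := HasDerivAt.fun_sum (u := Finset.range (N + 1)) fun k _ =>
        ((hasDerivAt_pow k s).const_mul (bernoulliMajorant ε k))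
      refine h.congr_deriv ?_
      rw [Finset.sum_range_succ']
      simp only [Nat.cast_zero, zero_mul, mul_zero, add_zero]
      refine Finset.sum_congr rfl fun k _ => ?_
      push_cast
      ring
    refine fun s hs => image_le_of_deriv_right_le_deriv_boundary
      (fun s _ => (hd s).continuousAt.continuousWithinAt)
      (fun s _ => (hd s).hasDerivWithinAt) ?_ Real.continuous_exp.continuousOn
      (fun s _ => (Real.hasDerivAt_exp s).hasDerivWithinAt) ?_ hs
    · simp [Finset.sum_range_succ', bernoulliMajorant_zero]
    · intro s hs
      have hs0 : 0 ≤ s := hs.1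
      have h1 := ih s ⟨hs.1, hs.2.le⟩
      have hnn : ∀ k, 0 ≤ bernoulliMajorant ε k * s ^ k := fun k =>
        mul_nonneg (bernoulliMajorant_nonneg hε k) (pow_nonneg hs0 k)
      have h2 := sum_range_conv_le_sq hnn N
      have h3 : 2 * ∑ k ∈ Finset.range N, (k + 1) * bernoulliMajorant ε (k + 1) * s ^ k =
          ∑ k ∈ Finset.range N, bernoulliMajorant ε k * s ^ k +
          ε * ∑ k ∈ Finset.range N, ∑ j ∈ Finset.range (k + 1),
            (bernoulliMajorant ε j * s ^ j) * (bernoulliMajorant ε (k - j) * s ^ (k - j)) := by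
        rw [Finset.mul_sum, Finset.mul_sum, ← Finset.sum_add_distrib]
        refine Finset.sum_congr rfl fun k _ => ?_
        have h4 : ∑ j ∈ Finset.range (k + 1),
            (bernoulliMajorant ε j * s ^ j) * (bernoulliMajorant ε (k - j) * s ^ (k - j)) =
            (∑ j ∈ Finset.range (k + 1),
              bernoulliMajorant ε j * bernoulliMajorant ε (k - j)) * s ^ k := by
          rw [Finset.sum_mul]
          refine Finset.sum_congr rfl fun j hj => ?_
          have : s ^ k = s ^ j * s ^ (k - j) := by
            rw [← pow_add]; congr 1; have := Finset.mem_range.1 hj; omega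
          rw [this]; ring
        rw [h4]
        linear_combination s ^ k * bernoulliMajorant_succ ε k
      have h5 : (∑ k ∈ Finset.range N, bernoulliMajorant ε k * s ^ k) ^ 2 ≤
          Real.exp s * Real.exp R := by
        rw [sq]
        exact mul_le_mul h1 (h1.trans (Real.exp_le_exp.2 hs.2.le))
          (Finset.sum_nonneg fun k _ => hnn k) (Real.exp_pos s).le
      have h6 := mul_le_mul_of_nonneg_left (h2.trans h5) hε
      have h7 := mul_le_mul_of_nonneg_left hR (Real.exp_pos s).le
      linarith

theorem bernoulliMajorant_le {ε R : ℝ} (hε : 0 ≤ ε) (hR0 : 0 < R) (hR : ε * Real.exp R ≤ 1)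
    (k : ℕ) : bernoulliMajorant ε k ≤ Real.exp R * (R ^ k)⁻¹ := by
  rw [← div_eq_mul_inv, le_div_iff₀ (by positivity)]
  refine le_trans ?_ (sum_bernoulliMajorant_le_exp hε hR (k + 1) R ⟨hR0.le, le_rfl⟩)
  exact Finset.single_le_sum (f := fun k => bernoulliMajorant ε k * R ^ k)
    (fun j _ => mul_nonneg (bernoulliMajorant_nonneg hε j) (by positivity)) (by simp)

theorem sum_choose_mul_choose (m j l : ℕ) :
    ∑ i ∈ Finset.range (m + 1), (i + j).choose j * (m - i + l).choose l =
      (m + (j + l) + 1).choose (j + l + 1) := by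
  have h : (PowerSeries.mk 1 : PowerSeries ℤ) ^ (j + 1) * PowerSeries.mk 1 ^ (l + 1) =
      PowerSeries.mk 1 ^ (j + l + 1 + 1) := by ring
  rw [PowerSeries.mk_one_pow_eq_mk_choose_add, PowerSeries.mk_one_pow_eq_mk_choose_add,
    PowerSeries.mk_one_pow_eq_mk_choose_add] at h
  have h2 := congrArg (PowerSeries.coeff m) h
  rw [PowerSeries.coeff_mul, Finset.Nat.sum_antidiagonal_eq_sum_range_succ_mk] at h2
  simp only [PowerSeries.coeff_mk] at h2
  have h3 : ∑ i ∈ Finset.range (m + 1), (j + i).choose j * (l + (m - i)).choose l =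
      (j + l + 1 + m).choose (j + l + 1) := by exact_mod_cast h2
  rw [show m + (j + l) + 1 = j + l + 1 + m by ring, ← h3]
  exact Finset.sum_congr rfl fun i _ => by rw [add_comm i, add_comm (m - i)]

theorem contDiffOn_quadHeatCoeff {g : ℝ → ℝ} {I : Set ℝ} (hI : IsOpen I)
    (hg : ContDiffOn ℝ (⊤ : ℕ∞) g I) (k : ℕ) :
    ContDiffOn ℝ (⊤ : ℕ∞) (quadHeatCoeff g k) I := by
  induction k using Nat.strong_induction_on with
  | _ k ih =>
    cases k with
    | zero => rwa [quadHeatCoeff_zero]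
    | succ k =>
      rw [quadHeatCoeff_succ]
      refine contDiffOn_const.mul (((ih k (by omega)).deriv_of_isOpen hI (by simp)).neg.add ?_)
      refine ContDiffOn.sum fun j hj => (ih j ?_).mul (ih (k - j) (by omega))
      exact Finset.mem_range.1 hj

theorem abs_iteratedDeriv_quadHeatCoeff_le {g : ℝ → ℝ} {I : Set ℝ} (hI : IsOpen I)
    (hg : ContDiffOn ℝ (⊤ : ℕ∞) g I) {A ρ : ℝ} (hA : 0 ≤ A) (hρ : 1 ≤ ρ)
    (hb : ∀ m : ℕ, ∀ t ∈ I, |iteratedDeriv m g t| ≤ A * m.factorial * ρ ^ m) (k : ℕ) :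
    ∀ m : ℕ, ∀ t ∈ I, |iteratedDeriv m (quadHeatCoeff g k) t| ≤
      A * bernoulliMajorant A k * (m.factorial * (m + k).choose k) * ρ ^ (m + k) := by
  induction k using Nat.strong_induction_on with
  | _ k ih =>
    cases k with
    | zero =>
      intro m t ht
      simpa [quadHeatCoeff_zero, bernoulliMajorant_zero] using hb m t ht
    | succ k =>
      intro m t ht
      have hsm : ∀ k, ∀ n : ℕ, ContDiffAt ℝ n (quadHeatCoeff g k) t := fun k n =>
        ((contDiffOn_quadHeatCoeff hI hg k).contDiffAt (hI.mem_nhds ht)).of_le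
          (by exact_mod_cast le_top)
      have hsd : ContDiffAt ℝ m (deriv (quadHeatCoeff g k)) t :=
        (((contDiffOn_quadHeatCoeff hI hg k).deriv_of_isOpen (m := (⊤ : ℕ∞)) hI
          (by simp)).contDiffAt (hI.mem_nhds ht)).of_le (by exact_mod_cast le_top)
      have hmul : ∀ j ∈ Finset.range (k + 1), ContDiffAt ℝ m
          (fun t => quadHeatCoeff g j t * quadHeatCoeff g (k - j) t) t :=
        fun j _ => (hsm j m).mul (hsm (k - j) m)
      rw [quadHeatCoeff_succ, iteratedDeriv_const_mul _ (hsd.neg.add (ContDiffAt.sum hmul)),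
        iteratedDeriv_fun_add hsd.neg (ContDiffAt.sum hmul), iteratedDeriv_fun_neg,
        iteratedDeriv_fun_sum hmul, ← iteratedDeriv_succ', abs_mul, abs_inv]
      set D := bernoulliMajorant A with hD
      have hDnn : ∀ k, 0 ≤ D k := bernoulliMajorant_nonneg hA
      set B : ℝ := m.factorial * (m + (k + 1)).choose (k + 1) with hB
      have hB0 : 0 ≤ B := by positivity
      have h1 : |iteratedDeriv (m + 1) (quadHeatCoeff g k) t| ≤
          A * ((k + 1) * D k) * B * ρ ^ (m + (k + 1)) := by
        refine (ih k (by omega) (m + 1) t ht).trans_eq ?_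
        have hc : (m + 1) * (m + 1 + k).choose k = (k + 1) * (m + (k + 1)).choose (k + 1) := by
          have := Nat.choose_succ_right_eq (m + 1 + k) k
          rw [show m + 1 + k - k = m + 1 by omega] at this
          rw [show m + (k + 1) = m + 1 + k by ring]
          linarith
        have hc' : ((m : ℝ) + 1) * (m + 1 + k).choose k =
            (k + 1) * (m + (k + 1)).choose (k + 1) := by exact_mod_cast hc
        rw [hB, Nat.factorial_succ, show m + 1 + k = m + (k + 1) by ring] at *
        push_cast
        linear_combination (A * D k * m.factorial * ρ ^ (m + (k + 1))) * hc'
      have h2 : ∀ j ∈ Finset.range (k + 1),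
          |iteratedDeriv m (fun t => quadHeatCoeff g j t * quadHeatCoeff g (k - j) t) t| ≤
          A * A * (D j * D (k - j)) * B * ρ ^ (m + (k + 1)) := by
        intro j hj
        have hjk : j < k + 1 := Finset.mem_range.1 hj
        rw [iteratedDeriv_fun_mul (hsm j m) (hsm (k - j) m)]
        calc _ ≤ ∑ i ∈ Finset.range (m + 1), A * A * (D j * D (k - j)) * m.factorial *
              ρ ^ (m + k) * ((i + j).choose j * (m - i + (k - j)).choose (k - j) : ℕ) := by
              refine (Finset.abs_sum_le_sum_abs _ _).trans (Finset.sum_le_sum fun i hi => ?_)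
              have him : i ≤ m := Nat.lt_succ_iff.1 (Finset.mem_range.1 hi)
              rw [abs_mul, abs_mul, Nat.abs_cast]
              have e1 := ih j hjk i t ht
              have e2 := ih (k - j) (by omega) (m - i) t ht
              have e3 : (m.choose i : ℝ) * i.factorial * (m - i).factorial = m.factorial := by
                exact_mod_cast Nat.choose_mul_factorial_mul_factorial him
              have e4 : ρ ^ (m + k) = ρ ^ (i + j) * ρ ^ (m - i + (k - j)) := by
                rw [← pow_add]; congr 1; omega
              rw [mul_assoc]
              refine (mul_le_mul_of_nonneg_left (mul_le_mul e1 e2 (abs_nonneg _)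
                ((abs_nonneg _).trans e1)) (Nat.cast_nonneg _)).trans_eq ?_
              rw [e4, ← e3]
              push_cast
              ring
          _ = A * A * (D j * D (k - j)) * B * ρ ^ (m + k) := by
              rw [← Finset.mul_sum, ← Nat.cast_sum, sum_choose_mul_choose, hB,
                show j + (k - j) = k by omega, add_assoc]
              ring
          _ ≤ _ := by
              have := hDnn j
              have := hDnn (k - j)
              have h : ρ ^ (m + k) ≤ ρ ^ (m + (k + 1)) := pow_le_pow_right₀ hρ (by omega)
              exact mul_le_mul_of_nonneg_left h (by positivity)
      have h3 : |-iteratedDeriv (m + 1) (quadHeatCoeff g k) t + ∑ j ∈ Finset.range (k + 1),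
            iteratedDeriv m (fun t => quadHeatCoeff g j t * quadHeatCoeff g (k - j) t) t| ≤
          A * ((k + 1) * D k) * B * ρ ^ (m + (k + 1)) +
          A * A * (∑ j ∈ Finset.range (k + 1), D j * D (k - j)) * B * ρ ^ (m + (k + 1)) := by
        refine (abs_add_le _ _).trans (add_le_add (by rwa [abs_neg]) ?_)
        refine (Finset.abs_sum_le_sum_abs _ _).trans ((Finset.sum_le_sum h2).trans_eq ?_)
        rw [Finset.mul_sum, Finset.sum_mul, Finset.sum_mul]
      rw [abs_of_pos (by positivity), inv_mul_le_iff₀ (by positivity)]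
      refine h3.trans ?_
      have h4 := bernoulliMajorant_succ A k
      rw [← hD] at h4
      have hS : 0 ≤ ∑ j ∈ Finset.range (k + 1), D j * D (k - j) :=
        Finset.sum_nonneg fun j _ => mul_nonneg (hDnn _) (hDnn _)
      set S := ∑ j ∈ Finset.range (k + 1), D j * D (k - j)
      have h5 : (k + 1) * D k + A * S ≤ (2 * k + 2) * (2 * k + 1) * D (k + 1) := by
        have : (2 * k + 2) * (2 * k + 1) * D (k + 1) = (2 * k + 1) * (D k + A * S) := by
          rw [← h4]; ring
        rw [this]
        have := mul_nonneg (Nat.cast_nonneg (α := ℝ) k) (hDnn k)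
        have := mul_nonneg (Nat.cast_nonneg (α := ℝ) k) (mul_nonneg hA hS)
        nlinarith
      have h6 := mul_le_mul_of_nonneg_left h5
        (show 0 ≤ A * B * ρ ^ (m + (k + 1)) by positivity)
      linarith

theorem contDiffOn_family_of_hasFDerivAt {F : ℕ → ℕ → ℝ × ℝ → ℝ} {U : Set (ℝ × ℝ)}
    (hU : IsOpen U)
    (hF : ∀ i j, ∀ p ∈ U, HasFDerivAt (F i j)
      (F i (j + 1) p • ContinuousLinearMap.fst ℝ ℝ ℝ +
        F (i + 1) j p • ContinuousLinearMap.snd ℝ ℝ ℝ) p) (i j : ℕ) :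
    ContDiffOn ℝ (⊤ : ℕ∞) (F i j) U := by
  rw [contDiffOn_infty]
  intro n
  induction n generalizing i j with
  | zero =>
    exact contDiffOn_zero.2 fun p hp => (hF i j p hp).continuousAt.continuousWithinAt
  | succ n ih =>
    push_cast
    rw [contDiffOn_succ_iff_fderiv_of_isOpen hU]
    refine ⟨fun p hp => (hF i j p hp).differentiableAt.differentiableWithinAt, by simp, ?_⟩
    exact (((ih i (j + 1)).smul contDiffOn_const).add ((ih (i + 1) j).smul contDiffOn_const)).congr
      fun p hp => (hF i j p hp).fderiv

theorem hasFDerivAt_tsum_family {f : ℕ → ℕ → ℕ → ℝ × ℝ → ℝ} {U : Set (ℝ × ℝ)}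
    (hU : IsOpen U) (hU' : IsPreconnected U) {M : ℕ → ℕ → ℕ → ℝ} (hM : ∀ i j, Summable (M i j))
    (hb : ∀ i j k, ∀ p ∈ U, |f i j k p| ≤ M i j k)
    (hf : ∀ i j k, ∀ p ∈ U, HasFDerivAt (f i j k)
      (f i (j + 1) k p • ContinuousLinearMap.fst ℝ ℝ ℝ +
        f (i + 1) j k p • ContinuousLinearMap.snd ℝ ℝ ℝ) p) (i j : ℕ) :
    ∀ p ∈ U, HasFDerivAt (fun p => ∑' k, f i j k p)
      ((∑' k, f i (j + 1) k p) • ContinuousLinearMap.fst ℝ ℝ ℝ +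
        (∑' k, f (i + 1) j k p) • ContinuousLinearMap.snd ℝ ℝ ℝ) p := by
  intro p hp
  have hs : ∀ i j, Summable fun k => f i j k p := fun i j =>
    Summable.of_norm_bounded (hM i j) fun k => hb i j k p hp
  have h := hasFDerivAt_tsum_of_isPreconnected ((hM i (j + 1)).add (hM (i + 1) j)) hU hU'
    (hf i j) (fun k p hp => ?_) hp (hs i j) hp
  · refine h.congr_fderiv ?_
    rw [Summable.tsum_add ((hs _ _).smul_const _) ((hs _ _).smul_const _),
      (hs _ _).tsum_smul_const, (hs _ _).tsum_smul_const]
  · refine (norm_add_le _ _).trans (add_le_add ?_ ?_)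
    · rw [norm_smul]
      exact (mul_le_of_le_one_right (norm_nonneg _) (ContinuousLinearMap.norm_fst_le ..)).trans
        (hb i (j + 1) k p hp)
    · rw [norm_smul]
      exact (mul_le_of_le_one_right (norm_nonneg _) (ContinuousLinearMap.norm_snd_le ..)).trans
        (hb (i + 1) j k p hp)

theorem norm_cexp_neg_inv_sq_le {t₀ : ℝ} (ht₀ : 0 < t₀) {z : ℂ} (hz : ‖z - t₀‖ ≤ t₀ / 4) :
    ‖Complex.exp (-1 / z ^ 2)‖ ≤ Real.exp (-(1 / 8 / t₀ ^ 2)) := by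
  rw [Complex.norm_exp, Real.exp_le_exp]
  have h1 : ‖z - t₀‖ ^ 2 ≤ (t₀ / 4) ^ 2 := pow_le_pow_left₀ (norm_nonneg _) hz 2
  rw [Complex.sq_norm, Complex.normSq_apply] at h1
  simp only [Complex.sub_re, Complex.ofReal_re, Complex.sub_im, Complex.ofReal_im, sub_zero] at h1
  have h2 : (z.re - t₀) ^ 2 ≤ (t₀ / 4) ^ 2 := by nlinarith [sq_nonneg z.im]
  have h3 := abs_le_of_sq_le_sq' h2 (by positivity)
  have hb : z.im ^ 2 ≤ (t₀ / 4) ^ 2 := by nlinarith [sq_nonneg (z.re - t₀)]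
  have hre : (-1 / z ^ 2).re = -((z.re ^ 2 - z.im ^ 2) / (z.re ^ 2 + z.im ^ 2) ^ 2) := by
    rw [Complex.div_re, Complex.normSq_apply]
    simp only [sq, Complex.mul_re, Complex.mul_im, Complex.neg_re, Complex.neg_im, Complex.one_re,
      Complex.one_im]
    rw [show (z.re * z.re - z.im * z.im) * (z.re * z.re - z.im * z.im) +
      (z.re * z.im + z.im * z.re) * (z.re * z.im + z.im * z.re) =
      (z.re * z.re + z.im * z.im) * (z.re * z.re + z.im * z.im) by ring]
    ring
  rw [hre, neg_le_neg_iff]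
  have ha : 0 < z.re := by linarith
  have ha1 : 9 / 16 * t₀ ^ 2 ≤ z.re ^ 2 := by nlinarith
  have ha2 : z.re ^ 2 ≤ 25 / 16 * t₀ ^ 2 := by nlinarith
  rw [div_div, div_le_div_iff₀ (by positivity) (by positivity)]
  have h4 : (z.re ^ 2 + z.im ^ 2) ^ 2 ≤ (13 / 8 * t₀ ^ 2) ^ 2 :=
    pow_le_pow_left₀ (by positivity) (by nlinarith) 2
  have h5 : 1 / 2 * t₀ ^ 2 ≤ z.re ^ 2 - z.im ^ 2 := by nlinarith
  have h6 := mul_le_mul_of_nonneg_right h5 (show 0 ≤ 8 * t₀ ^ 2 by positivity)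
  nlinarith [sq_nonneg (t₀ ^ 2)]

theorem analyticAt_cexp_neg_inv_sq {z : ℂ} (hz : z ≠ 0) :
    AnalyticAt ℂ (fun z : ℂ => Complex.exp (-1 / z ^ 2)) z :=
  (analyticAt_const.div (analyticAt_id.pow 2) (pow_ne_zero 2 hz)).cexp

theorem iteratedDeriv_exp_neg_inv_sq (m : ℕ) {t : ℝ} (ht : 0 < t) :
    iteratedDeriv m (fun t : ℝ => Real.exp (-1 / t ^ 2)) t =
      (iteratedDeriv m (fun z : ℂ => Complex.exp (-1 / z ^ 2)) t).re := by
  induction m generalizing t with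
  | zero =>
    simp only [iteratedDeriv_zero]
    rw [← Complex.exp_ofReal_re]
    push_cast
    rfl
  | succ m ih =>
    have hana : AnalyticAt ℂ (iteratedDeriv m fun z : ℂ => Complex.exp (-1 / z ^ 2)) (t : ℂ) := by
      rw [iteratedDeriv_eq_iterate]
      exact (analyticAt_cexp_neg_inv_sq (by exact_mod_cast ht.ne')).iterated_deriv m
    rw [iteratedDeriv_succ, iteratedDeriv_succ,
      ← hana.differentiableAt.hasDerivAt.real_of_complex.deriv]
    refine Filter.EventuallyEq.deriv_eq ?_
    filter_upwards [lt_mem_nhds ht] with s hs using ih hs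

theorem abs_iteratedDeriv_exp_neg_inv_sq_le {t₀ : ℝ} (ht₀ : 0 < t₀) (m : ℕ) :
    ∀ t ∈ Set.Ioo (7 / 8 * t₀) (9 / 8 * t₀),
      |iteratedDeriv m (fun t : ℝ => Real.exp (-1 / t ^ 2)) t| ≤
        Real.exp (-(1 / 8 / t₀ ^ 2)) * m.factorial * (8 / t₀) ^ m := by
  intro t ht
  have ht0 : 0 < t := by linarith [ht.1]
  rw [iteratedDeriv_exp_neg_inv_sq m ht0]
  refine (Complex.abs_re_le_norm _).trans ?_
  have hdist : ∀ z ∈ Metric.closedBall (t : ℂ) (t₀ / 8), ‖z - t₀‖ ≤ t₀ / 4 := by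
    intro z hz
    rw [mem_closedBall_iff_norm] at hz
    have h : ‖(t : ℂ) - t₀‖ ≤ t₀ / 8 := by
      rw [← Complex.ofReal_sub, Complex.norm_real, Real.norm_eq_abs, abs_le]
      constructor <;> linarith [ht.1, ht.2]
    have := norm_sub_le_norm_sub_add_norm_sub z (t : ℂ) (t₀ : ℂ)
    linarith
  have hne : ∀ z ∈ Metric.closedBall (t : ℂ) (t₀ / 8), z ≠ 0 := by
    rintro z hz rfl
    have := hdist 0 hz
    rw [zero_sub, norm_neg, Complex.norm_real, Real.norm_eq_abs, abs_of_pos ht₀] at this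
    linarith
  have h := Complex.norm_iteratedDeriv_le_of_forall_mem_sphere_norm_le (F := ℂ)
    (f := fun z : ℂ => Complex.exp (-1 / z ^ 2)) (c := (t : ℂ)) m
    (R := t₀ / 8) (by positivity)
    (DifferentiableOn.diffContOnCl_ball (U := Metric.closedBall (t : ℂ) (t₀ / 8))
      (fun z hz => (analyticAt_cexp_neg_inv_sq
        (hne z hz)).differentiableAt.differentiableWithinAt) subset_rfl)
    (fun z hz => norm_cexp_neg_inv_sq_le ht₀ (hdist z (Metric.sphere_subset_closedBall hz)))
  refine h.trans_eq ?_
  rw [div_pow, div_pow]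
  field_simp

theorem factorial_mul_choose_le (i k : ℕ) :
    i.factorial * (i + k).choose k ≤ ((i + 1) * (k + 1)) ^ i := by
  have h : i.factorial * (i + k).choose k = (k + 1).ascFactorial i := by
    rw [Nat.ascFactorial_eq_factorial_mul_choose, add_comm, Nat.choose_symm_add]
  rw [h]
  exact (Nat.ascFactorial_le_pow_add k i).trans (Nat.pow_le_pow_left (by nlinarith) i)

theorem contDiffOn_iteratedDeriv_of_isOpen {f : ℝ → ℝ} {I : Set ℝ} (hI : IsOpen I)
    (hf : ContDiffOn ℝ (⊤ : ℕ∞) f I) (m : ℕ) :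
    ContDiffOn ℝ (⊤ : ℕ∞) (iteratedDeriv m f) I := by
  induction m with
  | zero => rwa [iteratedDeriv_zero]
  | succ m ih =>
    rw [iteratedDeriv_succ]
    exact ih.deriv_of_isOpen hI (by simp)

/-- The `k`-th term of the series `∑ v_k(t) x ^ (2 k)`, differentiated `i` times in `t` and `j` times
in `x`. -/
noncomputable def quadHeatTerm (g : ℝ → ℝ) (i j k : ℕ) (p : ℝ × ℝ) : ℝ :=
  (2 * k).descFactorial j * p.1 ^ (2 * k - j) * iteratedDeriv i (quadHeatCoeff g k) p.2

theorem hasFDerivAt_quadHeatTerm {g : ℝ → ℝ} {I : Set ℝ} (hI : IsOpen I)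
    (hg : ContDiffOn ℝ (⊤ : ℕ∞) g I) (i j k : ℕ) {p : ℝ × ℝ} (hp : p.2 ∈ I) :
    HasFDerivAt (quadHeatTerm g i j k)
      (quadHeatTerm g i (j + 1) k p • ContinuousLinearMap.fst ℝ ℝ ℝ +
        quadHeatTerm g (i + 1) j k p • ContinuousLinearMap.snd ℝ ℝ ℝ) p := by
  have h1 : HasFDerivAt (fun p : ℝ × ℝ => p.1 ^ (2 * k - j))
      ((((2 * k - j : ℕ) : ℝ) * p.1 ^ (2 * k - j - 1)) • ContinuousLinearMap.fst ℝ ℝ ℝ) p :=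
    (hasDerivAt_pow (2 * k - j) p.1).comp_hasFDerivAt p hasFDerivAt_fst
  have hd : DifferentiableAt ℝ (iteratedDeriv i (quadHeatCoeff g k)) p.2 :=
    ((contDiffOn_iteratedDeriv_of_isOpen hI (contDiffOn_quadHeatCoeff hI hg k) i).contDiffAt
      (hI.mem_nhds hp)).differentiableAt (by simp)
  have h2 : HasFDerivAt (fun p : ℝ × ℝ => iteratedDeriv i (quadHeatCoeff g k) p.2)
      (iteratedDeriv (i + 1) (quadHeatCoeff g k) p.2 • ContinuousLinearMap.snd ℝ ℝ ℝ) p := by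
    rw [iteratedDeriv_succ]
    exact hd.hasDerivAt.comp_hasFDerivAt p hasFDerivAt_snd
  refine ((h1.const_mul ((2 * k).descFactorial j : ℝ)).mul h2).congr_fderiv ?_
  ext
  · simp [quadHeatTerm, Nat.descFactorial_succ, Nat.sub_sub]
    ring
  · simp [quadHeatTerm]

/-- The solution `∑ v_k(t) x ^ (2 k)` of the Cauchy problem with data on the axis `x = 0`. -/
noncomputable def quadHeatSolution (g : ℝ → ℝ) (x t : ℝ) : ℝ :=
  ∑' k, quadHeatCoeff g k t * x ^ (2 * k)

theorem quadHeatSolution_zero (g : ℝ → ℝ) (t : ℝ) : quadHeatSolution g 0 t = g t := by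
  rw [quadHeatSolution, tsum_eq_single 0 fun k hk => by simp [hk]]
  simp [quadHeatCoeff_zero]

section LocalSolution

variable {g : ℝ → ℝ} {I : Set ℝ} {A ρ R : ℝ}

theorem abs_quadHeatTerm_le (hI : IsOpen I)
    (hg : ContDiffOn ℝ (⊤ : ℕ∞) g I) (hA : 0 ≤ A) (hρ : 1 ≤ ρ)
    (hb : ∀ m : ℕ, ∀ t ∈ I, |iteratedDeriv m g t| ≤ A * m.factorial * ρ ^ m)
    (hR0 : 0 < R) (hR : A * Real.exp R ≤ 1) {X : ℝ} (hX : 0 < X) (i j k : ℕ)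
    {p : ℝ × ℝ} (hp : p ∈ Set.Ioo (-X) X ×ˢ I) :
    |quadHeatTerm g i j k p| ≤ 2 ^ j * (X ^ j)⁻¹ * A * Real.exp R * ρ ^ i * (i + 1) ^ i *
      ((k + 1) ^ (i + j) * (ρ * X ^ 2 / R) ^ k) := by
  rcases lt_or_ge (2 * k) j with h | h
  · rw [quadHeatTerm, Nat.descFactorial_eq_zero_iff_lt.2 h]
    simp only [Nat.cast_zero, zero_mul, abs_zero]
    positivity
  have h1 : ((2 * k).descFactorial j : ℝ) ≤ 2 ^ j * (k + 1) ^ j := by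
    have := (Nat.descFactorial_le_pow (2 * k) j).trans
      (Nat.pow_le_pow_left (show 2 * k ≤ 2 * (k + 1) by omega) j)
    rw [← mul_pow]
    exact_mod_cast this
  have h2 : |p.1| ^ (2 * k - j) ≤ (X ^ 2) ^ k * (X ^ j)⁻¹ := by
    rw [← pow_mul, ← pow_sub₀ X hX.ne' h]
    exact pow_le_pow_left₀ (abs_nonneg _) (abs_le.2 ⟨hp.1.1.le, hp.1.2.le⟩) _
  have h3 : (i.factorial * (i + k).choose k : ℝ) ≤ (i + 1) ^ i * (k + 1) ^ i := by
    rw [← mul_pow]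
    exact_mod_cast factorial_mul_choose_le i k
  have h4 := bernoulliMajorant_le hA hR0 hR k
  have h4' := bernoulliMajorant_nonneg hA k
  have h5 := abs_iteratedDeriv_quadHeatCoeff_le hI hg hA hρ hb k i p.2 hp.2
  rw [quadHeatTerm, abs_mul, abs_mul, Nat.abs_cast, abs_pow]
  calc _ ≤ 2 ^ j * (k + 1) ^ j * ((X ^ 2) ^ k * (X ^ j)⁻¹) *
        (A * (Real.exp R * (R ^ k)⁻¹) * ((i + 1) ^ i * (k + 1) ^ i) * ρ ^ (i + k)) := by
        refine mul_le_mul (mul_le_mul h1 h2 (by positivity) (by positivity))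
          (h5.trans ?_) (abs_nonneg _) (by positivity)
        gcongr
    _ = _ := by
        rw [div_pow, mul_pow, pow_add, pow_add]
        ring

theorem summable_quadHeatTerm_bound (hR0 : 0 < R) (hρ : 1 ≤ ρ) {X : ℝ}
    (hXR : ρ * X ^ 2 < R) (C : ℝ) (n : ℕ) :
    Summable fun k : ℕ => C * (((k : ℝ) + 1) ^ n * (ρ * X ^ 2 / R) ^ k) := by
  refine Summable.mul_left C ?_
  have hq0 : 0 ≤ ρ * X ^ 2 / R := by positivity
  have hq : ‖ρ * X ^ 2 / R‖ < 1 := by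
    rw [Real.norm_of_nonneg hq0, div_lt_one hR0]
    exact hXR
  refine Summable.of_nonneg_of_le (fun k => by positivity) (fun k => ?_)
    (((summable_pow_mul_geometric_of_norm_lt_one n hq).mul_left (2 ^ n)).add
      (summable_geometric_of_norm_lt_one hq))
  rcases k.eq_zero_or_pos with rfl | hk
  · simp
  · have h : ((k : ℝ) + 1) ^ n ≤ 2 ^ n * k ^ n := by
      rw [← mul_pow]
      have : (1 : ℝ) ≤ k := by exact_mod_cast hk
      exact pow_le_pow_left₀ (by positivity) (by linarith) n
    have := mul_le_mul_of_nonneg_right h (pow_nonneg hq0 k)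
    have := pow_nonneg hq0 k
    linarith

theorem quadHeatSolution_eq_tsum_term (g : ℝ → ℝ) :
    (fun p : ℝ × ℝ => quadHeatSolution g p.1 p.2) = fun p => ∑' k, quadHeatTerm g 0 0 k p := by
  funext p
  exact tsum_congr fun k => by simp [quadHeatTerm, mul_comm]

theorem quadHeatSolution_local (hI : IsOpen I) (hI' : Convex ℝ I)
    (hg : ContDiffOn ℝ (⊤ : ℕ∞) g I) (hA : 0 ≤ A) (hρ : 1 ≤ ρ)
    (hb : ∀ m : ℕ, ∀ t ∈ I, |iteratedDeriv m g t| ≤ A * m.factorial * ρ ^ m)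
    (hR0 : 0 < R) (hR : A * Real.exp R ≤ 1) {x t : ℝ} (hx : ρ * x ^ 2 < R) (ht : t ∈ I) :
    ContDiffAt ℝ (⊤ : ℕ∞) (fun p : ℝ × ℝ => quadHeatSolution g p.1 p.2) (x, t) ∧
    deriv (fun τ => quadHeatSolution g x τ) t +
      deriv (deriv (fun y => quadHeatSolution g y t)) x = quadHeatSolution g x t ^ 2 ∧
    |quadHeatSolution g x t| ≤ A * Real.exp (ρ * x ^ 2) := by
  obtain ⟨X, hxX, hXR⟩ : ∃ X, |x| < X ∧ ρ * X ^ 2 < R := by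
    have hc : Filter.Tendsto (fun X : ℝ => ρ * X ^ 2) (nhdsWithin |x| (Set.Ioi |x|))
        (nhds (ρ * |x| ^ 2)) :=
      (Continuous.tendsto (by fun_prop) _).mono_left nhdsWithin_le_nhds
    rw [sq_abs] at hc
    exact ((eventually_mem_nhdsWithin).and (hc.eventually_lt_const hx)).exists
  have hX : 0 < X := (abs_nonneg x).trans_lt hxX
  set U : Set (ℝ × ℝ) := Set.Ioo (-X) X ×ˢ I with hUdef
  have hU : IsOpen U := isOpen_Ioo.prod hI
  have hU' : IsPreconnected U := ((convex_Ioo _ _).prod hI').isPreconnected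
  have hmem : (x, t) ∈ U := ⟨abs_lt.1 hxX, ht⟩
  obtain ⟨M, hM, hbd⟩ : ∃ M : ℕ → ℕ → ℕ → ℝ, (∀ i j, Summable (M i j)) ∧
      ∀ i j k, ∀ p ∈ U, |quadHeatTerm g i j k p| ≤ M i j k :=
    ⟨_, fun _ _ => summable_quadHeatTerm_bound hR0 hρ hXR _ _,
      fun i j k _ hp => abs_quadHeatTerm_le hI hg hA hρ hb hR0 hR hX i j k hp⟩
  have hF := hasFDerivAt_tsum_family hU hU' hM hbd
    (fun i j k p hp => hasFDerivAt_quadHeatTerm hI hg i j k hp.2)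
  have hs : ∀ i j, Summable fun k => quadHeatTerm g i j k (x, t) := fun i j =>
    Summable.of_norm_bounded (hM i j) fun k => hbd i j k _ hmem
  have hu := quadHeatSolution_eq_tsum_term g
  have hu' : ∀ y τ, quadHeatSolution g y τ = ∑' k, quadHeatTerm g 0 0 k (y, τ) :=
    fun y τ => congrFun hu (y, τ)
  refine ⟨?_, ?_, ?_⟩
  · rw [hu]
    exact (contDiffOn_family_of_hasFDerivAt (F := fun i j p => ∑' k, quadHeatTerm g i j k p) hU
      hF 0 0).contDiffAt (hU.mem_nhds hmem)
  · have hdx : ∀ j, ∀ y ∈ Set.Ioo (-X) X,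
        HasDerivAt (fun y => ∑' k, quadHeatTerm g 0 j k (y, t))
          (∑' k, quadHeatTerm g 0 (j + 1) k (y, t)) y := by
      intro j y hy
      have h := (hF 0 j (y, t) ⟨hy, ht⟩).comp_hasDerivAt y
        ((hasDerivAt_id y).prodMk (hasDerivAt_const y t))
      exact h.congr_deriv (by simp)
    have hdt : HasDerivAt (fun τ => ∑' k, quadHeatTerm g 0 0 k (x, τ))
        (∑' k, quadHeatTerm g 1 0 k (x, t)) t := by
      have h := (hF 0 0 (x, t) hmem).comp_hasDerivAt t
        ((hasDerivAt_const t x).prodMk (hasDerivAt_id t))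
      exact h.congr_deriv (by simp)
    have hxx : deriv (deriv fun y => quadHeatSolution g y t) x =
        ∑' k, quadHeatTerm g 0 2 k (x, t) := by
      rw [← (hdx 1 x (abs_lt.1 hxX)).deriv]
      refine Filter.EventuallyEq.deriv_eq ?_
      filter_upwards [isOpen_Ioo.mem_nhds (abs_lt.1 hxX)] with y hy
      simp only [hu']
      exact (hdx 0 y hy).deriv
    rw [hxx]
    simp only [hu']
    rw [hdt.deriv, sq, tsum_mul_tsum_eq_tsum_sum_range_of_summable_norm (hs 0 0).norm
      (hs 0 0).norm, (hs 0 2).tsum_eq_zero_add]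
    have h0 : quadHeatTerm g 0 2 0 (x, t) = 0 := by simp [quadHeatTerm]
    rw [h0, zero_add, ← (hs 1 0).tsum_add ((summable_nat_add_iff 1).2 (hs 0 2))]
    refine tsum_congr fun k => ?_
    have hsum : ∑ j ∈ Finset.range (k + 1),
        quadHeatTerm g 0 0 j (x, t) * quadHeatTerm g 0 0 (k - j) (x, t) =
        x ^ (2 * k) * ∑ j ∈ Finset.range (k + 1),
          quadHeatCoeff g j t * quadHeatCoeff g (k - j) t := by
      rw [Finset.mul_sum]
      refine Finset.sum_congr rfl fun j hj => ?_
      have h : x ^ (2 * k) = x ^ (2 * j) * x ^ (2 * (k - j)) := by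
        rw [← pow_add]; congr 1; have := Finset.mem_range.1 hj; omega
      simp only [quadHeatTerm, Nat.descFactorial_zero, Nat.cast_one, one_mul, Nat.sub_zero,
        iteratedDeriv_zero]
      rw [h]
      ring
    have hk : ((2 * (k + 1)).descFactorial 2 : ℝ) = (2 * k + 2) * (2 * k + 1) := by
      rw [show 2 * (k + 1) = 2 * k + 1 + 1 by ring, Nat.succ_descFactorial_succ,
        Nat.succ_descFactorial_succ, Nat.descFactorial_zero]
      push_cast
      ring
    rw [hsum]
    simp only [quadHeatTerm, hk, Nat.descFactorial_zero, Nat.cast_one, one_mul, Nat.sub_zero,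
      iteratedDeriv_zero, iteratedDeriv_one]
    rw [quadHeatCoeff_succ, show 2 * (k + 1) - 2 = 2 * k by omega]
    field_simp
    ring
  · have hz0 : 0 ≤ ρ * x ^ 2 := by positivity
    have hterm : ∀ k, |quadHeatTerm g 0 0 k (x, t)| ≤
        A * (bernoulliMajorant A k * (ρ * x ^ 2) ^ k) := by
      intro k
      have h := abs_iteratedDeriv_quadHeatCoeff_le hI hg hA hρ hb k 0 t ht
      have he : |quadHeatTerm g 0 0 k (x, t)| =
          (x ^ 2) ^ k * |iteratedDeriv 0 (quadHeatCoeff g k) t| := by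
        simp [quadHeatTerm, abs_mul, pow_mul]
      rw [he]
      refine (mul_le_mul_of_nonneg_left h (by positivity)).trans_eq ?_
      simp [mul_pow]
      ring
    rw [hu', ← Real.norm_eq_abs]
    refine (norm_tsum_le_tsum_norm (hs 0 0).norm).trans
      (Real.tsum_le_of_sum_range_le (fun _ => norm_nonneg _) fun n => ?_)
    refine (Finset.sum_le_sum fun k _ => hterm k).trans ?_
    rw [← Finset.mul_sum]
    exact mul_le_mul_of_nonneg_left
      (sum_bernoulliMajorant_le_exp hA hR n _ ⟨hz0, hx.le⟩) hA

end LocalSolution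

theorem contDiffOn_exp_neg_inv_sq :
    ContDiffOn ℝ (⊤ : ℕ∞) (fun t : ℝ => Real.exp (-1 / t ^ 2)) (Set.Ioi 0) :=
  (contDiffOn_const.div (contDiffOn_id.pow 2) fun _ ht => pow_ne_zero 2 (ne_of_gt ht)).exp

/-- Tikhonov-type counterexample for the backward nonlinear heat equation
`(∂ₜ + ∂ₓₓ)u = u²`: a nontrivial local solution on the region `{0 < t ≤ T, x² ≤ c/t}`
with `u(0,t) = e^{-1/t²}` and `|u(x,t)| ≤ e^{-δ/t²}`. -/
theorem tikhonov_quadratic_counterexample :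
    ∃ (T c δ : ℝ) (u : ℝ → ℝ → ℝ),
      0 < T ∧ T ≤ 1 ∧ 0 < c ∧ 0 < δ ∧
      ContDiffOn ℝ (⊤ : ℕ∞) (fun p : ℝ × ℝ => u p.1 p.2)
        {p : ℝ × ℝ | 0 < p.2 ∧ p.2 ≤ T ∧ p.1 ^ 2 ≤ c / p.2} ∧
      (∀ x t : ℝ, 0 < t → t ≤ T → x ^ 2 ≤ c / t →
        deriv (fun τ => u x τ) t + deriv (deriv (fun y => u y t)) x = (u x t) ^ 2) ∧
      (∀ t : ℝ, 0 < t → t ≤ T → u 0 t = Real.exp (-1 / t ^ 2)) ∧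
      (∀ x t : ℝ, 0 < t → t ≤ T → x ^ 2 ≤ c / t →
        |u x t| ≤ Real.exp (-δ / t ^ 2)) := by
  have key : ∀ x t : ℝ, 0 < t → t ≤ 1 → x ^ 2 ≤ 1 / 128 / t →
      ContDiffAt ℝ (⊤ : ℕ∞)
        (fun p : ℝ × ℝ => quadHeatSolution (fun t => Real.exp (-1 / t ^ 2)) p.1 p.2) (x, t) ∧
      deriv (fun τ => quadHeatSolution (fun t => Real.exp (-1 / t ^ 2)) x τ) t +
        deriv (deriv (fun y => quadHeatSolution (fun t => Real.exp (-1 / t ^ 2)) y t)) x =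
        quadHeatSolution (fun t => Real.exp (-1 / t ^ 2)) x t ^ 2 ∧
      |quadHeatSolution (fun t => Real.exp (-1 / t ^ 2)) x t| ≤
        Real.exp (-(1 / 16) / t ^ 2) := by
    intro x t ht ht1 hx
    have hρx : 8 / t * x ^ 2 ≤ 1 / 16 / t ^ 2 := by
      refine (mul_le_mul_of_nonneg_left hx (by positivity)).trans_eq ?_
      field_simp
      norm_num
    have h16 : 1 / 16 / t ^ 2 < 1 / 8 / t ^ 2 := by gcongr; norm_num
    obtain ⟨h1, h2, h3⟩ := quadHeatSolution_local
      (I := Set.Ioo (7 / 8 * t) (9 / 8 * t)) (A := Real.exp (-(1 / 8 / t ^ 2)))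
      (ρ := 8 / t) (R := 1 / 8 / t ^ 2) isOpen_Ioo (convex_Ioo _ _)
      (contDiffOn_exp_neg_inv_sq.mono fun s hs => (show (0 : ℝ) < 7 / 8 * t by positivity).trans
        hs.1)
      (Real.exp_pos _).le (by rw [le_div_iff₀ ht]; linarith)
      (abs_iteratedDeriv_exp_neg_inv_sq_le ht) (by positivity)
      (by rw [← Real.exp_add]; simp) (hρx.trans_lt h16)
      (show t ∈ Set.Ioo (7 / 8 * t) (9 / 8 * t) by constructor <;> linarith)
    refine ⟨h1, h2, h3.trans ?_⟩
    rw [← Real.exp_add, Real.exp_le_exp]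
    have : -(1 / 16) / t ^ 2 = -(1 / 8 / t ^ 2) + 1 / 16 / t ^ 2 := by ring
    linarith
  refine ⟨1, 1 / 128, 1 / 16, quadHeatSolution fun t => Real.exp (-1 / t ^ 2), one_pos, le_rfl,
    by norm_num, by norm_num, ?_, ?_, ?_, ?_⟩
  · exact fun p hp => (key p.1 p.2 hp.1 hp.2.1 hp.2.2).1.contDiffWithinAt
  · exact fun x t ht ht1 hx => (key x t ht ht1 hx).2.1
  · exact fun t _ _ => quadHeatSolution_zero _ t
  · exact fun x t ht ht1 hx => (key x t ht ht1 hx).2.2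
end

section
/- Let Q : ℝ → ℝ be real-analytic in a neighborhood of 0 with Q(0) = 0 and Q'(0) = 0. Then there exist constants T ∈ (0,1], c > 0, δ > 0, and a smooth function u on the region Ω = {(x,t) ∈ ℝ × ℝ : 0 < t ≤ T, x² ≤ c/t} such that: (i) ∂_t u + ∂²_{xx} u = Q(∂_x u) on Ω; (ii) u(0,t) = e^{−1/t²} for all t ∈ (0,T] (in particular u is not identically zero); (iii) |u(x,t)| ≤ e^{−δ/t²} for all (x,t) ∈ Ω. -/
open Set hiding antidiagonal
open Filter Topology
open scoped Nat
open Finset.HasAntidiagonal (antidiagonal)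

/-- The coefficient functions `a n` are smooth, and the power series `∑ a n t * x ^ n` and all its
termwise time derivatives converge for `|x| < Z`, uniformly in `t ∈ I`. -/
def SmoothCoeffs (Z : ℝ) (I : Set ℝ) (a : ℕ → ℝ → ℝ) : Prop :=
  (∀ n, ContDiff ℝ (⊤ : ℕ∞) (a n)) ∧
    ∀ (k : ℕ) (ρ : ℝ), 0 < ρ → ρ < Z →
      ∃ C, ∀ n, ∀ t ∈ I, |iteratedDeriv k (a n) t| * ρ ^ n ≤ C

namespace SmoothCoeffs

variable {Z : ℝ} {I : Set ℝ} {a : ℕ → ℝ → ℝ}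

lemma deriv_coeff (h : SmoothCoeffs Z I a) : SmoothCoeffs Z I (fun n => deriv (a n)) := by
  refine ⟨fun n => ?_, fun k ρ h0 h1 => ?_⟩
  · have := h.1 n
    exact ((contDiff_infty_iff_deriv (𝕜 := ℝ)).1 this).2
  · obtain ⟨C, hC⟩ := h.2 (k + 1) ρ h0 h1
    refine ⟨C, fun n t ht => ?_⟩
    rw [← iteratedDeriv_succ']
    exact hC n t ht

lemma shift (h : SmoothCoeffs Z I a) :
    SmoothCoeffs Z I (fun n t => ((n : ℝ) + 1) * a (n + 1) t) := by
  refine ⟨fun n => contDiff_const.mul (h.1 _), fun k ρ h0 h1 => ?_⟩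
  obtain ⟨ρ', h2, h3⟩ := exists_between h1
  have h4 : 0 < ρ' := h0.trans h2
  obtain ⟨C, hC⟩ := h.2 k ρ' h4 h3
  have hr : |ρ / ρ'| < 1 := by
    rw [abs_of_pos (by positivity)]; exact (div_lt_one h4).2 h2
  obtain ⟨K, hK⟩ : ∃ K, ∀ n : ℕ, ((n : ℝ) + 1) * (ρ / ρ') ^ n ≤ K := by
    have h5 : Tendsto (fun n : ℕ => ((n : ℝ) + 1) * (ρ / ρ') ^ n) atTop (𝓝 (0 + 0)) := by
      simp only [add_mul, one_mul]
      refine Tendsto.add ?_ (tendsto_pow_atTop_nhds_zero_of_abs_lt_one hr)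
      simpa using tendsto_pow_const_mul_const_pow_of_abs_lt_one 1 hr
    obtain ⟨K, hK⟩ := h5.bddAbove_range
    exact ⟨K, fun n => hK ⟨n, rfl⟩⟩
  have hK0 : 0 ≤ K := by simpa using zero_le_one.trans (by simpa using hK 0)
  refine ⟨K * (C / ρ'), fun n t ht => ?_⟩
  have h6 := hC (n + 1) t ht
  rw [iteratedDeriv_const_mul_field, abs_mul, abs_of_nonneg (by positivity : (0:ℝ) ≤ n + 1)]
  calc ((n : ℝ) + 1) * |iteratedDeriv k (a (n + 1)) t| * ρ ^ n
      = (((n : ℝ) + 1) * (ρ / ρ') ^ n) *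
          ((|iteratedDeriv k (a (n + 1)) t| * ρ' ^ (n + 1)) / ρ') := by
        rw [div_pow, pow_succ]; field_simp
    _ ≤ K * (C / ρ') := by
        have := hK n
        gcongr

lemma exists_bound (h : SmoothCoeffs Z I a) {ρ : ℝ} (h0 : 0 < ρ) (h1 : ρ < Z) :
    ∃ v : ℕ → ℝ, Summable v ∧ ∀ n, ∀ t ∈ I, |a n t| * ρ ^ n ≤ v n := by
  obtain ⟨ρ', h2, h3⟩ := exists_between h1
  have h4 : 0 < ρ' := h0.trans h2
  obtain ⟨C, hC⟩ := h.2 0 ρ' h4 h3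
  refine ⟨fun n => C * (ρ / ρ') ^ n, (summable_geometric_of_lt_one (by positivity)
    ((div_lt_one h4).2 h2)).mul_left C, fun n t ht => ?_⟩
  have h5 := hC n t ht
  simp only [iteratedDeriv_zero] at h5
  calc |a n t| * ρ ^ n = |a n t| * ρ' ^ n * (ρ / ρ') ^ n := by
        rw [div_pow]; field_simp
    _ ≤ C * (ρ / ρ') ^ n := by gcongr

lemma summable_abs (h : SmoothCoeffs Z I a) {x t : ℝ} (hx : |x| < Z) (ht : t ∈ I) :
    Summable fun n => |a n t| * |x| ^ n := by
  obtain ⟨ρ, h1, h2⟩ := exists_between hx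
  obtain ⟨v, hv, hb⟩ := h.exists_bound ((abs_nonneg x).trans_lt h1) h2
  refine hv.of_nonneg_of_le (fun n => by positivity) fun n => le_trans ?_ (hb n t ht)
  gcongr

lemma summable (h : SmoothCoeffs Z I a) {x t : ℝ} (hx : |x| < Z) (ht : t ∈ I) :
    Summable fun n => a n t * x ^ n :=
  Summable.of_norm (by simpa [abs_mul, abs_pow] using h.summable_abs hx ht)

lemma hasFDerivAt (h : SmoothCoeffs Z I a) (hI : IsOpen I) (hIc : Convex ℝ I)
    {p : ℝ × ℝ} (hx : |p.1| < Z) (ht : p.2 ∈ I) :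
    HasFDerivAt (fun p : ℝ × ℝ => ∑' n, a n p.2 * p.1 ^ n)
      ((∑' n : ℕ, ((n : ℝ) + 1) * a (n + 1) p.2 * p.1 ^ n) • ContinuousLinearMap.fst ℝ ℝ ℝ +
        (∑' n, deriv (a n) p.2 * p.1 ^ n) • ContinuousLinearMap.snd ℝ ℝ ℝ) p := by
  obtain ⟨ρ, h1, h2⟩ := exists_between hx
  have h0 : 0 < ρ := (abs_nonneg _).trans_lt h1
  obtain ⟨v, hv, hvb⟩ := h.shift.exists_bound h0 h2
  obtain ⟨w, hw, hwb⟩ := h.deriv_coeff.exists_bound h0 h2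
  have hs : IsOpen (Ioo (-ρ) ρ ×ˢ I) := isOpen_Ioo.prod hI
  have hc : IsPreconnected (Ioo (-ρ) ρ ×ˢ I) := ((convex_Ioo _ _).prod hIc).isPreconnected
  have hp : p ∈ Ioo (-ρ) ρ ×ˢ I := ⟨abs_lt.1 h1, ht⟩
  have key := hasFDerivAt_tsum_of_isPreconnected (𝕜 := ℝ)
    (f := fun n (p : ℝ × ℝ) => a n p.2 * p.1 ^ n)
    (f' := fun n (p : ℝ × ℝ) => ((n : ℝ) * a n p.2 * p.1 ^ (n - 1)) • ContinuousLinearMap.fst ℝ ℝ ℝ +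
        (deriv (a n) p.2 * p.1 ^ n) • ContinuousLinearMap.snd ℝ ℝ ℝ)
    (u := fun n => (if n = 0 then 0 else v (n - 1)) + w n) (x₀ := p) (x := p) ?_ hs hc ?_ ?_ hp
    (h.summable hx ht) hp
  · have s1 : Summable fun n : ℕ => (n : ℝ) * a n p.2 * p.1 ^ (n - 1) := by
      rw [← summable_nat_add_iff 1]
      simpa using h.shift.summable hx ht
    have s2 := h.deriv_coeff.summable hx ht
    rw [Summable.tsum_add (s1.smul_const _) (s2.smul_const _), s1.tsum_smul_const,
      s2.tsum_smul_const, s1.tsum_eq_zero_add] at key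
    simpa using key
  · refine Summable.add ?_ hw
    rw [← summable_nat_add_iff 1]
    simpa using hv
  · intro n q hq
    have d1 : HasFDerivAt (fun p : ℝ × ℝ => a n p.2)
        (deriv (a n) q.2 • ContinuousLinearMap.snd ℝ ℝ ℝ) q :=
      (((h.1 n).differentiable (by simp)).differentiableAt.hasDerivAt.comp_hasFDerivAt q
        hasFDerivAt_snd)
    have d2 : HasFDerivAt (fun p : ℝ × ℝ => p.1 ^ n)
        (((n : ℝ) * q.1 ^ (n - 1)) • ContinuousLinearMap.fst ℝ ℝ ℝ) q :=
      (hasDerivAt_pow n q.1).comp_hasFDerivAt q hasFDerivAt_fst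
    refine (d1.mul d2).congr_fderiv ?_
    ext <;> simp <;> ring
  · intro n q hq
    have hq1 : |q.1| ≤ ρ := (abs_lt.2 hq.1).le
    have hn1 : ‖ContinuousLinearMap.fst ℝ ℝ ℝ‖ ≤ 1 := ContinuousLinearMap.norm_fst_le ..
    have hn2 : ‖ContinuousLinearMap.snd ℝ ℝ ℝ‖ ≤ 1 := ContinuousLinearMap.norm_snd_le ..
    refine (norm_add_le _ _).trans (add_le_add ?_ ?_)
    · rw [norm_smul]
      refine (mul_le_of_le_one_right (norm_nonneg _) hn1).trans ?_
      rcases n with _ | n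
      · simp
      · simp only [Nat.add_eq_zero_iff, one_ne_zero, and_false, if_false, Nat.add_sub_cancel]
        refine le_trans ?_ (hvb n q.2 hq.2)
        rw [norm_mul, norm_pow, Real.norm_eq_abs, Real.norm_eq_abs]
        push_cast
        gcongr
    · rw [norm_smul]
      refine (mul_le_of_le_one_right (norm_nonneg _) hn2).trans ?_
      refine le_trans ?_ (hwb n q.2 hq.2)
      rw [norm_mul, norm_pow, Real.norm_eq_abs, Real.norm_eq_abs]
      gcongr

lemma contDiffOn (h : SmoothCoeffs Z I a) (hI : IsOpen I) (hIc : Convex ℝ I) :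
    ContDiffOn ℝ (⊤ : ℕ∞) (fun p : ℝ × ℝ => ∑' n, a n p.2 * p.1 ^ n) (Ioo (-Z) Z ×ˢ I) := by
  have hs : IsOpen (Ioo (-Z) Z ×ˢ I) := isOpen_Ioo.prod hI
  have aux : ∀ (m : ℕ) (a : ℕ → ℝ → ℝ), SmoothCoeffs Z I a →
      ContDiffOn ℝ m (fun p : ℝ × ℝ => ∑' n, a n p.2 * p.1 ^ n) (Ioo (-Z) Z ×ˢ I) := by
    intro m
    induction m with
    | zero =>
      intro a h
      refine contDiffOn_zero.2 fun p hp => ?_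
      exact (h.hasFDerivAt hI hIc (abs_lt.2 hp.1) hp.2).continuousAt.continuousWithinAt
    | succ m ih =>
      intro a h
      push_cast
      rw [contDiffOn_succ_iff_hasFDerivWithinAt_of_uniqueDiffOn hs.uniqueDiffOn]
      refine ⟨by simp, _, ?_, fun p hp =>
        (h.hasFDerivAt hI hIc (abs_lt.2 hp.1) hp.2).hasFDerivWithinAt⟩
      exact ((ih _ h.shift).smul contDiffOn_const).add ((ih _ h.deriv_coeff).smul contDiffOn_const)
  exact contDiffOn_infty.2 fun m => aux m a h

lemma deriv_time (h : SmoothCoeffs Z I a) (hI : IsOpen I) (hIc : Convex ℝ I)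
    {x t : ℝ} (hx : |x| < Z) (ht : t ∈ I) :
    deriv (fun τ => ∑' n, a n τ * x ^ n) t = ∑' n, deriv (a n) t * x ^ n := by
  have h1 := HasFDerivAt.comp_hasDerivAt (f := fun τ : ℝ => (x, τ)) t
    (h.hasFDerivAt hI hIc (p := (x, t)) hx ht)
    ((hasDerivAt_const t x).prodMk (hasDerivAt_id t))
  simpa [Function.comp_def] using h1.deriv

lemma deriv_space (h : SmoothCoeffs Z I a) (hI : IsOpen I) (hIc : Convex ℝ I)
    {x t : ℝ} (hx : |x| < Z) (ht : t ∈ I) :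
    deriv (fun y => ∑' n, a n t * y ^ n) x = ∑' n : ℕ, ((n : ℝ) + 1) * a (n + 1) t * x ^ n := by
  have h1 := HasFDerivAt.comp_hasDerivAt (f := fun y : ℝ => (y, t)) x
    (h.hasFDerivAt hI hIc (p := (x, t)) hx ht)
    ((hasDerivAt_id x).prodMk (hasDerivAt_const x t))
  simpa [Function.comp_def] using h1.deriv

lemma deriv_deriv_space (h : SmoothCoeffs Z I a) (hI : IsOpen I) (hIc : Convex ℝ I)
    {x t : ℝ} (hx : |x| < Z) (ht : t ∈ I) :
    deriv (deriv (fun y => ∑' n, a n t * y ^ n)) x =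
      ∑' n : ℕ, ((n : ℝ) + 1) * (((n : ℝ) + 2) * a (n + 2) t) * x ^ n := by
  have h1 : deriv (fun y => ∑' n, a n t * y ^ n) =ᶠ[𝓝 x]
      fun y => ∑' n : ℕ, ((n : ℝ) + 1) * a (n + 1) t * y ^ n := by
    filter_upwards [(continuous_abs.isOpen_preimage _ isOpen_Iio).mem_nhds
      (show x ∈ abs ⁻¹' Iio Z from hx)] with y hy using h.deriv_space hI hIc hy ht
  rw [h1.deriv_eq, h.shift.deriv_space hI hIc hx ht]
  refine tsum_congr fun n => ?_
  push_cast
  ring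

end SmoothCoeffs

lemma sum_antidiagonal_choose_mul_choose (F : ℕ → ℕ → ℝ) (n k : ℕ) :
    ∑ p ∈ antidiagonal n, ∑ q ∈ antidiagonal k,
      ((n.choose p.1 : ℝ) * k.choose q.1) * F (p.1 + q.1) (p.2 + q.2) =
    ∑ l ∈ antidiagonal (n + k), ((n + k).choose l.1 : ℝ) * F l.1 l.2 := by
  induction n generalizing F with
  | zero => simp
  | succ n ih =>
    have h1 := Finset.sum_antidiagonal_choose_succ_mul
      (fun i j => ∑ q ∈ antidiagonal k, (k.choose q.1 : ℝ) * F (i + q.1) (j + q.2)) n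
    have h2 := Finset.sum_antidiagonal_choose_succ_mul F (n + k)
    have h3 : ∀ m : ℕ, ∀ p ∈ antidiagonal m, (m.choose p.2 : ℝ) = m.choose p.1 := by
      intro m p hp
      rw [Nat.choose_symm_of_eq_add (Finset.HasAntidiagonal.mem_antidiagonal.1 hp).symm]
    have h4 := ih (fun i j => F i (j + 1))
    have h5 := ih (fun i j => F (i + 1) j)
    simp only [Finset.mul_sum, mul_assoc] at h1 h4 h5 ⊢
    rw [h1, show n + 1 + k = n + k + 1 by ring, h2, ← h4]
    congr 1
    · simp only [add_right_comm]
    · rw [Finset.sum_congr (s₁ := antidiagonal (n + k)) rfl fun p hp => by rw [h3 _ p hp], ← h5]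
      refine Finset.sum_congr rfl fun p hp => ?_
      simp only [h3 _ p hp, add_right_comm]

/-- Up to order `N` in `x`, the function `∑ fᵢ(t) xⁱ` is majorised at every `t₀ ∈ I` by
`Ψ(x + γ (t - t₀))`, where `Ψ` has Taylor coefficients `ψ`. -/
def Majorised (I : Set ℝ) (γ : ℝ) (N : ℕ) (f : PowerSeries (ℝ → ℝ)) (ψ : ℕ → ℝ) : Prop :=
  ∀ i ≤ N, ContDiff ℝ (⊤ : ℕ∞) (PowerSeries.coeff i f) ∧
    ∀ (k : ℕ), ∀ t ∈ I, (i ! : ℝ) * |iteratedDeriv k (PowerSeries.coeff i f) t| ≤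
      γ ^ k * ((i + k)! * ψ (i + k))

namespace Majorised

variable {I : Set ℝ} {γ : ℝ} {N : ℕ} {f g : PowerSeries (ℝ → ℝ)} {ψ χ ω : ℕ → ℝ}

lemma mul (hf : Majorised I γ N f ψ) (hg : Majorised I γ N g χ) (hγ : 0 ≤ γ)
    (h : ∀ n, ∑ p ∈ antidiagonal n, ψ p.1 * χ p.2 ≤ ω n) : Majorised I γ N (f * g) ω := by
  intro n hn
  have hle : ∀ p ∈ antidiagonal n, p.1 ≤ N ∧ p.2 ≤ N := fun p hp => by
    have := Finset.HasAntidiagonal.mem_antidiagonal.1 hp; omega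
  rw [PowerSeries.coeff_mul]
  have e : (∑ p ∈ antidiagonal n, PowerSeries.coeff p.1 f * PowerSeries.coeff p.2 g) =
      fun t => ∑ p ∈ antidiagonal n, (PowerSeries.coeff p.1 f * PowerSeries.coeff p.2 g) t := by
    ext t; simp
  have hsm : ∀ p ∈ antidiagonal n,
      ContDiff ℝ (⊤ : ℕ∞) (PowerSeries.coeff p.1 f * PowerSeries.coeff p.2 g) :=
    fun p hp => (hf _ (hle p hp).1).1.mul (hg _ (hle p hp).2).1
  rw [e]
  refine ⟨ContDiff.sum hsm, fun k t ht => ?_⟩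
  rw [iteratedDeriv_fun_sum fun p hp => ((hsm p hp).of_le (by exact_mod_cast le_top)).contDiffAt]
  calc (n ! : ℝ) * |∑ p ∈ antidiagonal n,
        iteratedDeriv k (PowerSeries.coeff p.1 f * PowerSeries.coeff p.2 g) t|
      ≤ n ! * ∑ p ∈ antidiagonal n, ∑ q ∈ antidiagonal k, (k.choose q.1 : ℝ) *
          |iteratedDeriv q.1 (PowerSeries.coeff p.1 f) t| *
          |iteratedDeriv q.2 (PowerSeries.coeff p.2 g) t| := by
        gcongr
        refine (Finset.abs_sum_le_sum_abs _ _).trans (Finset.sum_le_sum fun p hp => ?_)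
        rw [iteratedDeriv_mul ((hf _ (hle p hp).1).1.of_le (by exact_mod_cast le_top)).contDiffAt
          ((hg _ (hle p hp).2).1.of_le (by exact_mod_cast le_top)).contDiffAt,
          ← Finset.Nat.sum_antidiagonal_eq_sum_range_succ (fun i j => (k.choose i : ℝ) *
            iteratedDeriv i (PowerSeries.coeff p.1 f) t *
            iteratedDeriv j (PowerSeries.coeff p.2 g) t)]
        refine (Finset.abs_sum_le_sum_abs _ _).trans (Finset.sum_le_sum fun q hq => ?_)
        rw [abs_mul, abs_mul, Nat.abs_cast]
    _ = ∑ p ∈ antidiagonal n, ∑ q ∈ antidiagonal k, ((n.choose p.1 : ℝ) * k.choose q.1) *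
          ((p.1 ! * |iteratedDeriv q.1 (PowerSeries.coeff p.1 f) t|) *
          (p.2 ! * |iteratedDeriv q.2 (PowerSeries.coeff p.2 g) t|)) := by
        rw [Finset.mul_sum]
        refine Finset.sum_congr rfl fun p hp => ?_
        rw [Finset.mul_sum]
        refine Finset.sum_congr rfl fun q hq => ?_
        have h1 := Finset.HasAntidiagonal.mem_antidiagonal.1 hp
        have h2 : (n ! : ℝ) = n.choose p.1 * p.1 ! * p.2 ! := by
          rw [← h1, Nat.choose_symm_add]; exact_mod_cast (Nat.add_choose_mul_factorial_mul_factorial _ _).symm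
        rw [h2]; ring
    _ ≤ ∑ p ∈ antidiagonal n, ∑ q ∈ antidiagonal k, ((n.choose p.1 : ℝ) * k.choose q.1) *
          ((γ ^ q.1 * ((p.1 + q.1)! * ψ (p.1 + q.1))) *
          (γ ^ q.2 * ((p.2 + q.2)! * χ (p.2 + q.2)))) := by
        refine Finset.sum_le_sum fun p hp => Finset.sum_le_sum fun q hq => ?_
        have h1 := (hf _ (hle p hp).1).2 q.1 t ht
        have h2 := (hg _ (hle p hp).2).2 q.2 t ht
        have h3 := (by positivity : 0 ≤ (p.1 ! : ℝ) *
          |iteratedDeriv q.1 (PowerSeries.coeff p.1 f) t|).trans h1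
        gcongr
    _ = γ ^ k * ∑ p ∈ antidiagonal n, ∑ q ∈ antidiagonal k, ((n.choose p.1 : ℝ) * k.choose q.1) *
          (((p.1 + q.1)! * ψ (p.1 + q.1)) * ((p.2 + q.2)! * χ (p.2 + q.2))) := by
        rw [Finset.mul_sum]
        refine Finset.sum_congr rfl fun p hp => ?_
        rw [Finset.mul_sum]
        refine Finset.sum_congr rfl fun q hq => ?_
        rw [← Finset.HasAntidiagonal.mem_antidiagonal.1 hq, pow_add]; ring
    _ = γ ^ k * ((n + k)! * ∑ l ∈ antidiagonal (n + k), ψ l.1 * χ l.2) := by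
        rw [sum_antidiagonal_choose_mul_choose (fun i j => (i ! * ψ i) * (j ! * χ j)),
          Finset.mul_sum (s := antidiagonal (n + k)) (a := ((n + k)! : ℝ))]
        congr 1
        refine Finset.sum_congr rfl fun l hl => ?_
        rw [← Finset.HasAntidiagonal.mem_antidiagonal.1 hl, ← Nat.add_choose_mul_factorial_mul_factorial,
          Nat.choose_symm_add]
        push_cast; ring
    _ ≤ γ ^ k * ((n + k)! * ω (n + k)) := by
        have := h (n + k)
        gcongr

lemma pow (hf : Majorised I γ N f ψ) (hγ : 0 ≤ γ) {ε : ℝ} (hε : 0 ≤ ε)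
    (h : ∀ n, ∑ p ∈ antidiagonal n, ψ p.1 * ψ p.2 ≤ ε * ψ n) (m : ℕ) :
    Majorised I γ N (f ^ (m + 1)) (fun n => ε ^ m * ψ n) := by
  induction m with
  | zero => simpa using hf
  | succ m ih =>
    rw [pow_succ f]
    refine ih.mul hf hγ fun n => ?_
    simp only [mul_assoc, ← Finset.mul_sum]
    rw [pow_succ, mul_assoc]
    have := h n
    gcongr

end Majorised

/-- The partial sums of `exp Λ`. -/
noncomputable def expPartialSum (Λ : ℝ) (n : ℕ) : ℝ := ∑ j ∈ Finset.range (n + 1), Λ ^ j / j !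

section expPartialSum

variable {Λ : ℝ}

lemma one_le_expPartialSum (hΛ : 0 ≤ Λ) (n : ℕ) : 1 ≤ expPartialSum Λ n := by
  rw [expPartialSum, Finset.sum_range_succ']
  have : 0 ≤ ∑ j ∈ Finset.range n, Λ ^ (j + 1) / (j + 1)! :=
    Finset.sum_nonneg fun j _ => by positivity
  simpa using this

lemma expPartialSum_le_exp (hΛ : 0 ≤ Λ) (n : ℕ) : expPartialSum Λ n ≤ Real.exp Λ :=
  Real.sum_le_exp_of_nonneg hΛ _

lemma expPartialSum_mono (hΛ : 0 ≤ Λ) : Monotone (expPartialSum Λ) := fun m n h =>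
  Finset.sum_le_sum_of_subset_of_nonneg (Finset.range_subset_range.2 (by omega))
    fun j _ _ => by positivity

lemma mul_expPartialSum_le (hΛ : 0 ≤ Λ) (n : ℕ) :
    Λ * expPartialSum Λ n ≤ (n + 1) * expPartialSum Λ (n + 1) := by
  rw [expPartialSum, expPartialSum, Finset.sum_range_succ' _ (n + 1), Finset.mul_sum, mul_add,
    Finset.mul_sum]
  refine le_add_of_le_of_nonneg (Finset.sum_le_sum fun j hj => ?_) (by positivity)
  have hj' : (j : ℝ) + 1 ≤ n + 1 := by exact_mod_cast Finset.mem_range.1 hj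
  rw [Nat.factorial_succ]
  push_cast
  calc Λ * (Λ ^ j / j !) = (j + 1) * (Λ ^ (j + 1) / ((j + 1) * j !)) := by
        field_simp; ring
    _ ≤ _ := by gcongr

end expPartialSum

lemma sum_range_inv_sq_le (n : ℕ) :
    ∑ i ∈ Finset.range (n + 1), ((i : ℝ) + 1)⁻¹ ^ 2 ≤ 2 - ((n : ℝ) + 1)⁻¹ := by
  induction n with
  | zero => norm_num
  | succ n ih =>
    rw [Finset.sum_range_succ]
    push_cast
    have : ((n : ℝ) + 1 + 1)⁻¹ ^ 2 ≤ ((n : ℝ) + 1)⁻¹ - ((n : ℝ) + 1 + 1)⁻¹ := by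
      rw [inv_sub_inv (by positivity) (by positivity), inv_pow, inv_eq_one_div]
      rw [div_le_div_iff₀ (by positivity) (by positivity)]
      nlinarith [(Nat.cast_nonneg n : (0:ℝ) ≤ n)]
    linarith

lemma sum_antidiagonal_inv_sq_mul_inv_sq_le (n : ℕ) :
    ∑ p ∈ antidiagonal n, ((p.1 : ℝ) + 1)⁻¹ ^ 2 * ((p.2 : ℝ) + 1)⁻¹ ^ 2 ≤
      8 * ((n : ℝ) + 1)⁻¹ ^ 2 := by
  have h1 : ∀ p ∈ antidiagonal n, ((p.1 : ℝ) + 1)⁻¹ ^ 2 * ((p.2 : ℝ) + 1)⁻¹ ^ 2 ≤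
      2 * ((n : ℝ) + 1)⁻¹ ^ 2 * (((p.1 : ℝ) + 1)⁻¹ ^ 2 + ((p.2 : ℝ) + 1)⁻¹ ^ 2) := by
    intro p hp
    have h2 : (p.1 : ℝ) + p.2 = n := by exact_mod_cast Finset.HasAntidiagonal.mem_antidiagonal.1 hp
    rw [← h2]
    have ha : (0 : ℝ) ≤ p.1 := Nat.cast_nonneg _
    have hb : (0 : ℝ) ≤ p.2 := Nat.cast_nonneg _
    generalize (p.1 : ℝ) = a at *
    generalize (p.2 : ℝ) = b at *
    have e : 2 * (a + b + 1)⁻¹ ^ 2 * ((a + 1)⁻¹ ^ 2 + (b + 1)⁻¹ ^ 2) =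
      (2 * ((a + 1) ^ 2 + (b + 1) ^ 2) * (a + b + 1)⁻¹ ^ 2) *
        ((a + 1)⁻¹ ^ 2 * (b + 1)⁻¹ ^ 2) := by
      field_simp; ring
    rw [e]
    refine le_mul_of_one_le_left (by positivity) ?_
    rw [inv_pow, ← div_eq_mul_inv, one_le_div (by positivity)]
    nlinarith [sq_nonneg (a - b)]
  refine (Finset.sum_le_sum h1).trans ?_
  rw [← Finset.mul_sum, Finset.sum_add_distrib]
  have h2 := sum_range_inv_sq_le n
  have h3 : 0 ≤ ((n : ℝ) + 1)⁻¹ := by positivity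
  rw [Finset.Nat.sum_antidiagonal_eq_sum_range_succ (fun i _ => ((i : ℝ) + 1)⁻¹ ^ 2),
    ← Finset.Nat.sum_antidiagonal_swap]
  simp only [Prod.snd_swap]
  rw [Finset.Nat.sum_antidiagonal_eq_sum_range_succ (fun i _ => ((i : ℝ) + 1)⁻¹ ^ 2)]
  calc _ ≤ 2 * ((n : ℝ) + 1)⁻¹ ^ 2 * (2 + 2) := by
        gcongr <;> exact h2.trans (by linarith)
    _ = _ := by ring

/-- The coefficients of the majorant of `∂ₓu`. -/
noncomputable def weight (A Z Λ : ℝ) (n : ℕ) : ℝ :=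
  A * Z⁻¹ ^ n * expPartialSum Λ n * ((n : ℝ) + 1)⁻¹ ^ 2

section weight

variable {A Z Λ : ℝ}

lemma weight_nonneg (hA : 0 ≤ A) (hZ : 0 < Z) (hΛ : 0 ≤ Λ) (n : ℕ) : 0 ≤ weight A Z Λ n := by
  have := zero_le_one.trans (one_le_expPartialSum hΛ n)
  unfold weight
  positivity

lemma le_weight (hA : 0 ≤ A) (hZ : 0 < Z) (hΛ : 0 ≤ Λ) (n : ℕ) :
    A * Z⁻¹ ^ n * ((n : ℝ) + 1)⁻¹ ^ 2 ≤ weight A Z Λ n := by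
  have := one_le_expPartialSum hΛ n
  unfold weight
  exact mul_le_mul_of_nonneg_right (le_mul_of_one_le_right (by positivity) this) (by positivity)

lemma weight_le (hA : 0 ≤ A) (hZ : 0 < Z) (hΛ : 0 ≤ Λ) (n : ℕ) :
    weight A Z Λ n ≤ A * Real.exp Λ * Z⁻¹ ^ n := by
  have h1 := expPartialSum_le_exp hΛ n
  have h2 : ((n : ℝ) + 1)⁻¹ ^ 2 ≤ 1 :=
    pow_le_one₀ (by positivity) (inv_le_one_of_one_le₀ (by linarith [(Nat.cast_nonneg n : (0:ℝ) ≤ n)]))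
  calc weight A Z Λ n ≤ A * Z⁻¹ ^ n * Real.exp Λ * 1 := by
        unfold weight; gcongr
    _ = _ := by ring

lemma sum_weight_mul_weight_le (hZ : 0 < Z) (hΛ : 0 ≤ Λ) (n : ℕ) :
    ∑ p ∈ antidiagonal n, weight A Z Λ p.1 * weight A Z Λ p.2 ≤
      (8 * A * Real.exp Λ) * weight A Z Λ n := by
  have h0 := zero_le_one.trans (one_le_expPartialSum hΛ n)
  calc ∑ p ∈ antidiagonal n, weight A Z Λ p.1 * weight A Z Λ p.2
      ≤ ∑ p ∈ antidiagonal n, (A ^ 2 * Z⁻¹ ^ n * Real.exp Λ * expPartialSum Λ n) *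
        (((p.1 : ℝ) + 1)⁻¹ ^ 2 * ((p.2 : ℝ) + 1)⁻¹ ^ 2) := by
        refine Finset.sum_le_sum fun p hp => ?_
        have h1 := Finset.HasAntidiagonal.mem_antidiagonal.1 hp
        have h2 := expPartialSum_le_exp hΛ p.1
        have h3 := expPartialSum_mono hΛ (show p.2 ≤ n by omega)
        have h4 := zero_le_one.trans (one_le_expPartialSum hΛ p.1)
        have h5 := zero_le_one.trans (one_le_expPartialSum hΛ p.2)
        calc weight A Z Λ p.1 * weight A Z Λ p.2
            = A ^ 2 * Z⁻¹ ^ n * (expPartialSum Λ p.1 * expPartialSum Λ p.2) *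
              (((p.1 : ℝ) + 1)⁻¹ ^ 2 * ((p.2 : ℝ) + 1)⁻¹ ^ 2) := by
              rw [← h1, pow_add]; unfold weight; ring
          _ ≤ A ^ 2 * Z⁻¹ ^ n * (Real.exp Λ * expPartialSum Λ n) *
              (((p.1 : ℝ) + 1)⁻¹ ^ 2 * ((p.2 : ℝ) + 1)⁻¹ ^ 2) := by gcongr
          _ = _ := by ring
    _ ≤ (A ^ 2 * Z⁻¹ ^ n * Real.exp Λ * expPartialSum Λ n) * (8 * ((n : ℝ) + 1)⁻¹ ^ 2) := by
        rw [← Finset.mul_sum]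
        have := sum_antidiagonal_inv_sq_mul_inv_sq_le n
        gcongr
    _ = _ := by unfold weight; ring

lemma two_mul_weight_le (hA : 0 ≤ A) (hZ : 0 < Z) {γ : ℝ} (hγ : 0 ≤ γ) (hΛ : 8 * γ * Z ≤ Λ)
    (n : ℕ) : 2 * γ * weight A Z Λ n ≤ (n + 1) * weight A Z Λ (n + 1) := by
  have hΛ0 : 0 ≤ Λ := le_trans (by positivity) hΛ
  have h1 := mul_expPartialSum_le hΛ0 n
  have h0 := zero_le_one.trans (one_le_expPartialSum hΛ0 n)
  have h2 : 2 * γ * Z * ((n : ℝ) + 1)⁻¹ ^ 2 ≤ Λ * ((n : ℝ) + 2)⁻¹ ^ 2 := by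
    have : ((n : ℝ) + 1)⁻¹ ^ 2 ≤ 4 * ((n : ℝ) + 2)⁻¹ ^ 2 := by
      rw [inv_pow, inv_pow, ← div_eq_mul_inv, inv_eq_one_div,
        div_le_div_iff₀ (by positivity) (by positivity)]
      nlinarith [(Nat.cast_nonneg n : (0:ℝ) ≤ n)]
    calc 2 * γ * Z * ((n : ℝ) + 1)⁻¹ ^ 2 ≤ 2 * γ * Z * (4 * ((n : ℝ) + 2)⁻¹ ^ 2) := by gcongr
      _ = 8 * γ * Z * ((n : ℝ) + 2)⁻¹ ^ 2 := by ring
      _ ≤ _ := by gcongr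
  calc 2 * γ * weight A Z Λ n
      = A * Z⁻¹ ^ (n + 1) * expPartialSum Λ n * (2 * γ * Z * ((n : ℝ) + 1)⁻¹ ^ 2) := by
        rw [pow_succ, weight]
        linear_combination (-2 * γ * A * Z⁻¹ ^ n * expPartialSum Λ n * ((n : ℝ) + 1)⁻¹ ^ 2) *
          inv_mul_cancel₀ hZ.ne'
    _ ≤ A * Z⁻¹ ^ (n + 1) * expPartialSum Λ n * (Λ * ((n : ℝ) + 2)⁻¹ ^ 2) := by gcongr
    _ = A * Z⁻¹ ^ (n + 1) * (Λ * expPartialSum Λ n) * ((n : ℝ) + 2)⁻¹ ^ 2 := by ring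
    _ ≤ A * Z⁻¹ ^ (n + 1) * ((n + 1) * expPartialSum Λ (n + 1)) * ((n : ℝ) + 2)⁻¹ ^ 2 := by gcongr
    _ = _ := by unfold weight; push_cast; ring

end weight
lemma exists_eq_of_causal {E : Type*} [Inhabited E] (S : (ℕ → E) → ℕ → E)
    (h : ∀ n a b, (∀ m < n, a m = b m) → S a n = S b n) : ∃ a : ℕ → E, ∀ n, a n = S a n := by
  have h1 : ∀ N n, n < N → S^[N] default n = S^[N + 1] default n := by
    intro N
    induction N with
    | zero => intro n hn; omega
    | succ N ih =>
      intro n hn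
      rw [Function.iterate_succ_apply' S (N + 1), Function.iterate_succ_apply' S N]
      refine h n _ _ fun m hm => ?_
      rw [← Function.iterate_succ_apply' S N]
      exact ih m (by omega)
  have h2 : ∀ n N, n + 1 ≤ N → S^[N] default n = S^[n + 1] default n := by
    intro n N hN
    induction N, hN using Nat.le_induction with
    | base => rfl
    | succ N hN ih => rw [← h1 N n (by omega), ih]
  refine ⟨fun n => S^[n + 1] default n, fun n => ?_⟩
  change S^[n + 1] default n = _
  rw [Function.iterate_succ_apply' S n]
  exact h n _ _ fun m hm => h2 m n hm

lemma PowerSeries.coeff_pow_congr {R : Type*} [CommSemiring R] {f g : PowerSeries R} {n : ℕ}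
    (h : ∀ i ≤ n, coeff i f = coeff i g) (m : ℕ) :
    ∀ i ≤ n, coeff i (f ^ m) = coeff i (g ^ m) := by
  induction m with
  | zero => simp
  | succ m ih =>
    intro i hi
    rw [pow_succ, pow_succ, coeff_mul, coeff_mul]
    refine Finset.sum_congr rfl fun p hp => ?_
    have := Finset.HasAntidiagonal.mem_antidiagonal.1 hp
    rw [ih p.1 (by omega), h p.2 (by omega)]

/-- The formal power series `∂ₓ (∑ aₙ(t) xⁿ)`. -/
noncomputable def spaceDeriv (a : ℕ → ℝ → ℝ) : PowerSeries (ℝ → ℝ) :=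
  PowerSeries.mk fun n t => ((n : ℝ) + 1) * a (n + 1) t

/-- The coefficient of `xⁿ` in `∑ₘ qₘ vᵐ`, for `v` without constant term. -/
noncomputable def compCoeff (q : ℕ → ℝ) (v : PowerSeries (ℝ → ℝ)) (n : ℕ) (t : ℝ) : ℝ :=
  ∑ m ∈ Finset.range (n + 1), q m * PowerSeries.coeff n (v ^ m) t

/-- `∑ aₙ(t) xⁿ` solves `(∂ₜ + ∂ₓₓ)u = ∑ₘ qₘ (∂ₓu)ᵐ` formally, with `u = g` and `∂ₓu = 0` at
`x = 0`. -/
structure IsFormalSolution (q : ℕ → ℝ) (g : ℝ → ℝ) (a : ℕ → ℝ → ℝ) : Prop where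
  zero : a 0 = g
  one : a 1 = 0
  add_two : ∀ n, a (n + 2) = fun t =>
    (((n : ℝ) + 1) * ((n : ℝ) + 2))⁻¹ * (compCoeff q (spaceDeriv a) n t - deriv (a n) t)

lemma exists_isFormalSolution (q : ℕ → ℝ) (g : ℝ → ℝ) : ∃ a, IsFormalSolution q g a := by
  obtain ⟨a, ha⟩ := exists_eq_of_causal (E := ℝ → ℝ) (fun a n => match n with
    | 0 => g
    | 1 => 0
    | n + 2 => fun t => (((n : ℝ) + 1) * ((n : ℝ) + 2))⁻¹ *
        (compCoeff q (spaceDeriv a) n t - deriv (a n) t)) (by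
      intro n a b h
      match n with
      | 0 => rfl
      | 1 => rfl
      | n + 2 =>
        ext t
        have h1 : ∀ m, PowerSeries.coeff n (spaceDeriv a ^ m) =
            PowerSeries.coeff n (spaceDeriv b ^ m) := fun m =>
          PowerSeries.coeff_pow_congr (n := n) (fun i hi => by
            simp only [spaceDeriv, PowerSeries.coeff_mk, h (i + 1) (by omega)]) m n le_rfl
        simp only [compCoeff, h1, h n (by omega)])
  exact ⟨a, ha 0, ha 1, fun n => ha (n + 2)⟩

/-- The coefficients of the majorant of `u`. -/
noncomputable def primitiveWeight (M A Z Λ : ℝ) : ℕ → ℝ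
  | 0 => M
  | n + 1 => weight A Z Λ n / (n + 1)

lemma factorial_mul_primitiveWeight (M A Z Λ : ℝ) (n : ℕ) :
    ((n + 1)! : ℝ) * primitiveWeight M A Z Λ (n + 1) = n ! * weight A Z Λ n := by
  rw [Nat.factorial_succ, primitiveWeight]
  push_cast
  field_simp

/-- Every partial derivative of the formal solution at `x = 0` is bounded by that of its
majorant. -/
lemma IsFormalSolution.bound {q : ℕ → ℝ} {g : ℝ → ℝ} {a : ℕ → ℝ → ℝ}
    (h : IsFormalSolution q g a) {I : Set ℝ} {M A Z Λ γ : ℝ}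
    (hA : 0 ≤ A) (hZ : 0 < Z) (hγ : 0 ≤ γ) (hΛ : 8 * γ * Z ≤ Λ)
    (hq0 : q 0 = 0)
    (hq : ∀ n, ∑ m ∈ Finset.range n, |q (m + 1)| * (8 * A * Real.exp Λ) ^ m ≤ γ)
    (hg : ContDiff ℝ (⊤ : ℕ∞) g)
    (hgb : ∀ k, ∀ t ∈ I, |iteratedDeriv k g t| ≤ γ ^ k * (k ! * primitiveWeight M A Z Λ k))
    (n : ℕ) : ContDiff ℝ (⊤ : ℕ∞) (a n) ∧ ∀ k, ∀ t ∈ I,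
      (n ! : ℝ) * |iteratedDeriv k (a n) t| ≤
        γ ^ k * ((n + k)! * primitiveWeight M A Z Λ (n + k)) := by
  have hΛ0 : 0 ≤ Λ := le_trans (by positivity) hΛ
  have hw := weight_nonneg hA hZ hΛ0
  induction n using Nat.strong_induction_on with
  | _ n ih =>
  match n, ih with
  | 0, _ =>
    rw [h.zero]
    refine ⟨hg, fun k t ht => ?_⟩
    simpa using hgb k t ht
  | 1, _ =>
    rw [h.one]
    refine ⟨contDiff_const, fun k t ht => ?_⟩
    rw [add_comm, factorial_mul_primitiveWeight]
    have : iteratedDeriv k (0 : ℝ → ℝ) t = 0 := by simp [Pi.zero_def]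
    rw [this]
    have := hw k
    simp only [abs_zero, mul_zero]
    positivity
  | n + 2, ih =>
    have hv : Majorised I γ n (spaceDeriv a) (weight A Z Λ) := by
      intro i hi
      obtain ⟨h1, h2⟩ := ih (i + 1) (by omega)
      simp only [spaceDeriv, PowerSeries.coeff_mk]
      refine ⟨contDiff_const.mul h1, fun k t ht => ?_⟩
      have h3 := h2 k t ht
      rw [add_right_comm i 1 k, factorial_mul_primitiveWeight] at h3
      rw [iteratedDeriv_const_mul_field, abs_mul, abs_of_nonneg (by positivity : (0 : ℝ) ≤ i + 1)]
      refine le_of_eq_of_le ?_ h3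
      rw [Nat.factorial_succ]
      push_cast
      ring
    have hp := hv.pow hγ (by positivity) (sum_weight_mul_weight_le (A := A) hZ hΛ0)
    obtain ⟨ha1, ha2⟩ := ih n (by omega)
    have hda : ContDiff ℝ (⊤ : ℕ∞) (deriv (a n)) :=
      ((contDiff_infty_iff_deriv (𝕜 := ℝ)).1 ha1).2
    have hc : compCoeff q (spaceDeriv a) n = fun t => ∑ m ∈ Finset.range n,
        q (m + 1) * PowerSeries.coeff n (spaceDeriv a ^ (m + 1)) t := by
      ext t
      rw [compCoeff, Finset.sum_range_succ', hq0, zero_mul, add_zero]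
    have hcs : ∀ m ∈ Finset.range n, ContDiff ℝ (⊤ : ℕ∞)
        (fun t => q (m + 1) * PowerSeries.coeff n (spaceDeriv a ^ (m + 1)) t) :=
      fun m _ => contDiff_const.mul (hp m n le_rfl).1
    have hcd : ContDiff ℝ (⊤ : ℕ∞) (compCoeff q (spaceDeriv a) n) := by
      rw [hc]; exact ContDiff.sum hcs
    rw [h.add_two]
    refine ⟨contDiff_const.mul (hcd.sub hda), fun k t ht => ?_⟩
    have hk : ((k : ℕ) : WithTop ℕ∞) ≤ ((⊤ : ℕ∞) : WithTop ℕ∞) := by exact_mod_cast le_top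
    have b1 : (n ! : ℝ) * |iteratedDeriv k (compCoeff q (spaceDeriv a) n) t| ≤
        γ * (γ ^ k * ((n + k)! * weight A Z Λ (n + k))) := by
      rw [hc, iteratedDeriv_fun_sum fun m hm => ((hcs m hm).of_le hk).contDiffAt]
      have := hw (n + k)
      calc _ ≤ (n ! : ℝ) * ∑ m ∈ Finset.range n, |iteratedDeriv k
            (fun t => q (m + 1) * PowerSeries.coeff n (spaceDeriv a ^ (m + 1)) t) t| := by
            gcongr
            exact Finset.abs_sum_le_sum_abs _ _
        _ ≤ ∑ m ∈ Finset.range n, (|q (m + 1)| * (8 * A * Real.exp Λ) ^ m) *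
            (γ ^ k * ((n + k)! * weight A Z Λ (n + k))) := by
            rw [Finset.mul_sum]
            refine Finset.sum_le_sum fun m hm => ?_
            rw [iteratedDeriv_const_mul_field, abs_mul]
            have h3 := mul_le_mul_of_nonneg_left ((hp m n le_rfl).2 k t ht) (abs_nonneg (q (m + 1)))
            refine le_of_eq_of_le (by ring) (h3.trans (le_of_eq (by ring)))
        _ ≤ _ := by
            rw [← Finset.sum_mul]
            exact mul_le_mul_of_nonneg_right (hq n) (by positivity)
    have b2 : (n ! : ℝ) * |iteratedDeriv k (deriv (a n)) t| ≤
        γ * (γ ^ k * ((n + k)! * weight A Z Λ (n + k))) := by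
      have := ha2 (k + 1) t ht
      rw [← iteratedDeriv_succ']
      refine this.trans (le_of_eq ?_)
      rw [← add_assoc, factorial_mul_primitiveWeight, pow_succ]
      ring
    have b3 := two_mul_weight_le hA hZ hγ hΛ (n + k)
    rw [iteratedDeriv_const_mul_field, abs_mul, abs_of_nonneg (by positivity),
      iteratedDeriv_fun_sub (hcd.of_le hk).contDiffAt (hda.of_le hk).contDiffAt,
      add_right_comm n 2 k, factorial_mul_primitiveWeight, Nat.factorial_succ, Nat.factorial_succ,
      Nat.factorial_succ]
    push_cast at b3 ⊢
    calc ((n : ℝ) + 1 + 1) * ((n + 1) * n !) * ((((n : ℝ) + 1) * (n + 2))⁻¹ *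
          |iteratedDeriv k (compCoeff q (spaceDeriv a) n) t - iteratedDeriv k (deriv (a n)) t|)
        = n ! * |iteratedDeriv k (compCoeff q (spaceDeriv a) n) t -
            iteratedDeriv k (deriv (a n)) t| := by
          field_simp; ring
      _ ≤ n ! * (|iteratedDeriv k (compCoeff q (spaceDeriv a) n) t| +
            |iteratedDeriv k (deriv (a n)) t|) := by
          gcongr; exact abs_sub _ _
      _ ≤ γ ^ k * (n + k)! * (2 * γ * weight A Z Λ (n + k)) := by linarith
      _ ≤ γ ^ k * (n + k)! * ((n + k + 1) * weight A Z Λ (n + k + 1)) := by gcongr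
      _ = _ := by ring
lemma primitiveWeight_le {M A Z Λ : ℝ} (hM : 0 ≤ M) (hA : 0 ≤ A) (hZ : 0 < Z) (hΛ : 0 ≤ Λ)
    (n : ℕ) : primitiveWeight M A Z Λ n ≤ (M + Z * A * Real.exp Λ) * Z⁻¹ ^ n := by
  cases n with
  | zero =>
    have : 0 ≤ Z * A * Real.exp Λ := by positivity
    simpa [primitiveWeight] using this
  | succ n =>
    have h1 := weight_le hA hZ hΛ n
    calc weight A Z Λ n / (n + 1) ≤ weight A Z Λ n :=
          div_le_self (weight_nonneg hA hZ hΛ n) (by linarith [(Nat.cast_nonneg n : (0 : ℝ) ≤ n)])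
      _ ≤ A * Real.exp Λ * Z⁻¹ ^ n := h1
      _ = Z * A * Real.exp Λ * Z⁻¹ ^ (n + 1) := by
          rw [pow_succ]
          linear_combination (-A * Real.exp Λ * Z⁻¹ ^ n) * mul_inv_cancel₀ hZ.ne'
      _ ≤ _ := by gcongr; linarith

lemma SmoothCoeffs.of_bound {a : ℕ → ℝ → ℝ} {I : Set ℝ} {M A Z Λ γ : ℝ}
    (hM : 0 ≤ M) (hA : 0 ≤ A) (hZ : 0 < Z) (hΛ : 0 ≤ Λ) (hγ : 0 ≤ γ)
    (h : ∀ n, ContDiff ℝ (⊤ : ℕ∞) (a n) ∧ ∀ k, ∀ t ∈ I,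
      (n ! : ℝ) * |iteratedDeriv k (a n) t| ≤
        γ ^ k * ((n + k)! * primitiveWeight M A Z Λ (n + k))) :
    SmoothCoeffs Z I a := by
  refine ⟨fun n => (h n).1, fun k ρ h0 h1 => ?_⟩
  have hs := (summable_descFactorial_mul_geometric_of_norm_lt_one (R := ℝ) k (r := ρ / Z) (by
    rw [Real.norm_of_nonneg (by positivity)]; exact (div_lt_one hZ).2 h1)).tendsto_atTop_zero
  obtain ⟨C, hC⟩ := hs.bddAbove_range
  refine ⟨γ ^ k * (M + Z * A * Real.exp Λ) * Z⁻¹ ^ k * C, fun n t ht => ?_⟩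
  have h2 : (((n + k).descFactorial k : ℕ) : ℝ) * (ρ / Z) ^ n ≤ C := hC ⟨n, rfl⟩
  have h3 := (h n).2 k t ht
  have h4 : ((n + k)! : ℝ) = n ! * (n + k).descFactorial k := by
    have := Nat.factorial_mul_descFactorial (show k ≤ n + k by omega)
    rw [Nat.add_sub_cancel] at this
    exact_mod_cast this.symm
  have h5 : (0 : ℝ) < n ! := by positivity
  have h6 : |iteratedDeriv k (a n) t| ≤
      γ ^ k * ((n + k).descFactorial k * primitiveWeight M A Z Λ (n + k)) := by
    rw [h4] at h3
    refine le_of_mul_le_mul_left (h3.trans (le_of_eq (by ring))) h5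
  have h7 := primitiveWeight_le hM hA hZ hΛ (n + k)
  calc |iteratedDeriv k (a n) t| * ρ ^ n
      ≤ γ ^ k * ((n + k).descFactorial k * ((M + Z * A * Real.exp Λ) * Z⁻¹ ^ (n + k))) * ρ ^ n := by
        refine mul_le_mul_of_nonneg_right (h6.trans ?_) (by positivity)
        gcongr
    _ = γ ^ k * (M + Z * A * Real.exp Λ) * Z⁻¹ ^ k *
          ((n + k).descFactorial k * (ρ / Z) ^ n) := by
        rw [div_eq_mul_inv, mul_pow, pow_add]; ring
    _ ≤ _ := by gcongr

namespace PowerSeries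

lemma summable_abs_coeff_pow {f : PowerSeries ℝ} (hf : Summable fun n => |coeff n f|) (m : ℕ) :
    (Summable fun n => |coeff n (f ^ m)|) ∧ ∑' n, coeff n (f ^ m) = (∑' n, coeff n f) ^ m ∧
      ∑' n, |coeff n (f ^ m)| ≤ (∑' n, |coeff n f|) ^ m := by
  induction m with
  | zero =>
    have h0 : ∀ n, n ≠ 0 → coeff n (1 : PowerSeries ℝ) = 0 := fun n hn => by
      simp [coeff_one, hn]
    simp only [pow_zero]
    refine ⟨summable_of_ne_finset_zero (s := {0}) fun n hn => by
      simp [h0 n (by simpa using hn)], ?_, ?_⟩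
    · rw [tsum_eq_single 0 h0]; simp
    · rw [tsum_eq_single 0 fun n hn => by simp [h0 n hn]]; simp
  | succ m ih =>
    obtain ⟨h1, h2, h3⟩ := ih
    have h4 := summable_norm_sum_mul_antidiagonal_of_summable_norm (f := fun n => coeff n (f ^ m))
      (g := fun n => coeff n f) h1 hf
    have h5 := tsum_mul_tsum_eq_tsum_sum_antidiagonal_of_summable_norm
      (f := fun n => coeff n (f ^ m)) (g := fun n => coeff n f) h1 hf
    have h1' : Summable fun n => ‖|coeff n (f ^ m)|‖ := by simpa using h1
    have hf' : Summable fun n => ‖|coeff n f|‖ := by simpa using hf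
    have h6 := tsum_mul_tsum_eq_tsum_sum_antidiagonal_of_summable_norm
      (f := fun n => |coeff n (f ^ m)|) (g := fun n => |coeff n f|) h1' hf'
    have h7 := summable_norm_sum_mul_antidiagonal_of_summable_norm
      (f := fun n => |coeff n (f ^ m)|) (g := fun n => |coeff n f|) h1' hf'
    simp only [pow_succ, coeff_mul]
    refine ⟨h4, by rw [← h5, h2], ?_⟩
    calc _ ≤ ∑' n, ∑ p ∈ antidiagonal n, |coeff p.1 (f ^ m)| * |coeff p.2 f| := by
          refine h4.tsum_le_tsum (fun n => ?_) h7.of_norm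
          exact (Finset.abs_sum_le_sum_abs _ _).trans
            (le_of_eq (Finset.sum_congr rfl fun p _ => abs_mul _ _))
      _ = (∑' n, |coeff n (f ^ m)|) * ∑' n, |coeff n f| := h6.symm
      _ ≤ _ := by gcongr

/-- Composition of absolutely convergent series. -/
lemma tsum_comp_eq {f : PowerSeries ℝ} (hf : Summable fun n => |coeff n f|)
    (hf0 : coeff 0 f = 0) {q : ℕ → ℝ} {r : ℝ} (hr : ∑' n, |coeff n f| ≤ r)
    (hq : Summable fun m => |q m| * r ^ m) :
    ∑' n, ∑ m ∈ Finset.range (n + 1), q m * coeff n (f ^ m) =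
      ∑' m, q m * (∑' n, coeff n f) ^ m := by
  have hs : Summable (Function.uncurry fun m n : ℕ => q m * coeff n (f ^ m)) := by
    refine Summable.of_norm ((summable_prod_of_nonneg fun _ => norm_nonneg _).2 ⟨fun m => ?_, ?_⟩)
    · simpa [abs_mul] using (summable_abs_coeff_pow hf m).1.mul_left |q m|
    · refine hq.of_nonneg_of_le (fun m => tsum_nonneg fun _ => norm_nonneg _) fun m => ?_
      simp only [Function.uncurry_apply_pair, norm_mul, Real.norm_eq_abs]
      rw [tsum_mul_left]
      gcongr
      refine (summable_abs_coeff_pow hf m).2.2.trans ?_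
      have : 0 ≤ ∑' n, |coeff n f| := tsum_nonneg fun n => abs_nonneg _
      gcongr
  have h0 : ∀ n m, m ∉ Finset.range (n + 1) → q m * coeff n (f ^ m) = 0 := by
    intro n m hm
    rw [coeff_of_lt_order, mul_zero]
    have h1 : (1 : ℕ∞) ≤ f.order := by
      refine le_order f 1 fun i hi => ?_
      have : i = 0 := by
        have : i < 1 := by exact_mod_cast hi
        omega
      rw [this, hf0]
    have h2 : (m : ℕ∞) ≤ (f ^ m).order := by
      refine le_trans ?_ (le_order_pow f m)
      simpa using nsmul_le_nsmul_right h1 m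
    refine lt_of_lt_of_le ?_ h2
    have : ¬ m < n + 1 := by simpa using hm
    exact_mod_cast (by omega : n < m)
  calc _ = ∑' n, ∑' m, q m * coeff n (f ^ m) :=
        tsum_congr fun n => (tsum_eq_sum (h0 n)).symm
    _ = ∑' m, ∑' n, q m * coeff n (f ^ m) := hs.tsum_comm
    _ = _ := tsum_congr fun m => by rw [tsum_mul_left, (summable_abs_coeff_pow hf m).2.1]

end PowerSeries

lemma tsum_compCoeff {q : ℕ → ℝ} {v : PowerSeries (ℝ → ℝ)} {x t r : ℝ}
    (hv : Summable fun n => |PowerSeries.coeff n v t| * |x| ^ n)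
    (hv0 : PowerSeries.coeff 0 v t = 0)
    (hr : ∑' n, |PowerSeries.coeff n v t| * |x| ^ n ≤ r)
    (hq : Summable fun m => |q m| * r ^ m) :
    ∑' n, compCoeff q v n t * x ^ n = ∑' m, q m * (∑' n, PowerSeries.coeff n v t * x ^ n) ^ m := by
  have hc : ∀ m n : ℕ, PowerSeries.coeff n (PowerSeries.rescale x
      (PowerSeries.map (Pi.evalRingHom (fun _ : ℝ => ℝ) t) v) ^ m) =
      PowerSeries.coeff n (v ^ m) t * x ^ n := by
    intro m n
    rw [← map_pow, ← map_pow, PowerSeries.coeff_rescale, PowerSeries.coeff_map, mul_comm]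
    rfl
  have hc1 := hc 1
  simp only [pow_one] at hc1
  have := PowerSeries.tsum_comp_eq (q := q) (r := r) (f := PowerSeries.rescale x
      (PowerSeries.map (Pi.evalRingHom (fun _ : ℝ => ℝ) t) v))
      (by simpa only [hc1, abs_mul, abs_pow] using hv) (by rw [hc1, hv0, zero_mul])
      (by simpa only [hc1, abs_mul, abs_pow] using hr) hq
  simp only [hc, hc1] at this
  rw [← this]
  refine tsum_congr fun n => ?_
  rw [compCoeff, Finset.sum_mul]
  exact Finset.sum_congr rfl fun m _ => by ring

lemma AnalyticAt.exists_hasSum_of_deriv_eq_zero {Q : ℝ → ℝ} (hQ : AnalyticAt ℝ Q 0)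
    (h0 : Q 0 = 0) (h1 : deriv Q 0 = 0) :
    ∃ (q : ℕ → ℝ) (R K : ℝ), 0 < R ∧ 0 < K ∧ q 0 = 0 ∧ q 1 = 0 ∧ (∀ m, |q m| * R ^ m ≤ K) ∧
      ∀ y, |y| < R → HasSum (fun m => q m * y ^ m) (Q y) := by
  obtain ⟨p, r, hp⟩ := hQ
  obtain ⟨R, hR0, hR⟩ := ENNReal.lt_iff_exists_nnreal_btwn.1 hp.r_pos
  have hR0' : (0 : ℝ) < R := by exact_mod_cast hR0
  obtain ⟨K, hK0, hK⟩ := p.norm_mul_pow_le_of_lt_radius (hR.trans_le hp.r_le)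
  refine ⟨p.coeff, R, K, hR0', hK0, ?_, ?_, fun m => ?_, fun y hy => ?_⟩
  · have := hp.coeff_zero (fun _ => 1)
    exact this.trans h0
  · have := hp.hasFPowerSeriesAt.deriv
    exact this.symm.trans h1
  · simpa [FormalMultilinearSeries.norm_apply_eq_norm_coef] using hK m
  · have := hp.hasSum (y := y) (by
      refine lt_trans ?_ hR
      rw [edist_zero_right, enorm_eq_nnnorm]
      exact_mod_cast hy)
    simp only [zero_add] at this
    simpa [FormalMultilinearSeries.apply_eq_pow_smul_coeff, mul_comm] using this
lemma iteratedDeriv_eq_re_of_eqOn {f : ℝ → ℝ} {F : ℂ → ℂ} {U : Set ℂ} {I : Set ℝ}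
    (hU : IsOpen U) (hI : IsOpen I) (hF : DifferentiableOn ℂ F U)
    (hIU : ∀ t ∈ I, (t : ℂ) ∈ U) (hf : ∀ t ∈ I, f t = (F t).re) (k : ℕ) :
    ∀ t ∈ I, iteratedDeriv k f t = (iteratedDeriv k F t).re := by
  induction k with
  | zero => simpa using hf
  | succ k ih =>
    intro t ht
    have h1 : iteratedDeriv k f =ᶠ[𝓝 t] fun s => (iteratedDeriv k F s).re := by
      filter_upwards [hI.mem_nhds ht] with s hs using ih s hs
    rw [iteratedDeriv_succ, iteratedDeriv_succ, h1.deriv_eq]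
    have h2 : AnalyticAt ℂ F t := hF.analyticAt (hU.mem_nhds (hIU t ht))
    have h3 := (h2.iterated_deriv k).differentiableAt.hasDerivAt
    rw [← iteratedDeriv_eq_iterate] at h3
    exact h3.real_of_complex.deriv

lemma re_inv_sq_ge {w : ℂ} (hw : ‖w - 1‖ ≤ 1 / 4) : 1 / 5 ≤ ((w ^ 2)⁻¹).re := by
  have h : (w.re - 1) ^ 2 + w.im ^ 2 ≤ 1 / 16 := by
    have h1 := Complex.sq_norm (w - 1)
    rw [Complex.normSq_apply] at h1
    simp at h1
    nlinarith [norm_nonneg (w - 1)]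
  have h1 : (w ^ 2).re = w.re ^ 2 - w.im ^ 2 := by rw [sq]; simp; ring
  have h2 : Complex.normSq (w ^ 2) = (w.re ^ 2 + w.im ^ 2) ^ 2 := by
    rw [map_pow, Complex.normSq_apply]; ring
  have h3 : 3 / 4 ≤ w.re := by nlinarith [sq_nonneg w.im]
  have h4 : w.re ≤ 5 / 4 := by nlinarith [sq_nonneg w.im]
  rw [Complex.inv_re, h1, h2, div_le_div_iff₀ (by norm_num) (by positivity)]
  have h5 : w.im ^ 2 ≤ 1 / 16 := by nlinarith [sq_nonneg (w.re - 1)]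
  have h6 : w.re ^ 2 + w.im ^ 2 ≤ 25 / 16 := by nlinarith
  have h7 : (w.re ^ 2 + w.im ^ 2) ^ 2 ≤ 625 / 256 := by
    have : 0 ≤ w.re ^ 2 + w.im ^ 2 := by positivity
    nlinarith
  nlinarith

lemma abs_iteratedDeriv_expNegInvGlue_sq_le {s t : ℝ} (hs : 0 < s) (ht : |t - s| ≤ s / 8) (k : ℕ) :
    |iteratedDeriv k (fun t => expNegInvGlue (t ^ 2)) t| ≤
      k ! * Real.exp (-1 / (5 * s ^ 2)) * (8 / s) ^ k := by
  have hF : DifferentiableOn ℂ (fun z : ℂ => Complex.exp (-(z ^ 2)⁻¹)) {0}ᶜ := by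
    intro z hz
    have : z ^ 2 ≠ 0 := pow_ne_zero _ hz
    exact DifferentiableAt.differentiableWithinAt (by fun_prop (disch := assumption))
  have ht0 : 0 < t := by linarith [(abs_le.1 ht).1]
  rw [iteratedDeriv_eq_re_of_eqOn (F := fun z : ℂ => Complex.exp (-(z ^ 2)⁻¹)) (U := {0}ᶜ)
    (I := Ioi 0) isOpen_compl_singleton isOpen_Ioi hF (fun t ht => by simpa using ht.ne')
    (fun t ht => ?_) k t ht0]
  · refine (Complex.abs_re_le_norm _).trans ?_
    have hball : ∀ z ∈ Metric.closedBall (t : ℂ) (s / 8), ‖z / s - 1‖ ≤ 1 / 4 := by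
      intro z hz
      have h1 : z / s - 1 = (z - s) / s := by
        have : (s : ℂ) ≠ 0 := by exact_mod_cast hs.ne'
        field_simp
      have h2 : ‖z - s‖ ≤ s / 8 + s / 8 := by
        refine (norm_sub_le_norm_sub_add_norm_sub z t s).trans (add_le_add ?_ ?_)
        · simpa [dist_eq_norm] using hz
        · rw [← Complex.ofReal_sub, Complex.norm_real]; exact ht
      rw [h1, norm_div, Complex.norm_real, Real.norm_of_nonneg hs.le, div_le_iff₀ hs]
      linarith
    have hne : ∀ z ∈ Metric.closedBall (t : ℂ) (s / 8), z ≠ 0 := by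
      rintro z hz rfl
      have := hball 0 hz
      norm_num at this
    refine (Complex.norm_iteratedDeriv_le_of_forall_mem_sphere_norm_le
      (C := Real.exp (-1 / (5 * s ^ 2))) k (by positivity : 0 < s / 8)
      (hF.diffContOnCl_ball fun z hz => hne z hz) fun z hz => ?_).trans ?_
    · rw [Complex.norm_exp]
      refine Real.exp_le_exp.2 ?_
      have h1 := re_inv_sq_ge (hball z (Metric.sphere_subset_closedBall hz))
      have h2 : (((z / s) ^ 2)⁻¹).re = s ^ 2 * ((z ^ 2)⁻¹).re := by
        rw [div_pow, inv_div, div_eq_mul_inv, ← Complex.ofReal_pow, Complex.re_ofReal_mul]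
      rw [h2] at h1
      rw [Complex.neg_re, neg_div, neg_le_neg_iff, div_le_iff₀ (by positivity)]
      linarith
    · rw [div_pow, div_pow]
      apply le_of_eq
      field_simp
  · have h1 : 0 < t ^ 2 := pow_pos ht 2
    rw [← Complex.ofReal_pow, ← Complex.ofReal_inv, ← Complex.ofReal_neg, Complex.exp_ofReal_re,
      expNegInvGlue, if_neg h1.not_ge]

section FormalSolution

variable {q : ℕ → ℝ} {g : ℝ → ℝ} {a : ℕ → ℝ → ℝ} {I : Set ℝ} {M A Z Λ γ x t : ℝ}

lemma abs_coeff_le_of_bound (h : ∀ n, ContDiff ℝ (⊤ : ℕ∞) (a n) ∧ ∀ k, ∀ t ∈ I,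
      (n ! : ℝ) * |iteratedDeriv k (a n) t| ≤
        γ ^ k * ((n + k)! * primitiveWeight M A Z Λ (n + k))) (n : ℕ) (ht : t ∈ I) :
    |a n t| ≤ primitiveWeight M A Z Λ n := by
  have h1 := (h n).2 0 t ht
  simp only [iteratedDeriv_zero, pow_zero, one_mul, add_zero] at h1
  exact le_of_mul_le_mul_left h1 (by positivity)

lemma pow_mul_inv_pow_le (hZ : 0 < Z) (hx : |x| ≤ Z / 2) (n : ℕ) :
    Z⁻¹ ^ n * |x| ^ n ≤ (1 / 2) ^ n := by
  rw [← mul_pow]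
  gcongr
  rw [inv_mul_le_iff₀ hZ]
  linarith

lemma tsum_le_two_mul_of_le {b : ℕ → ℝ} {B : ℝ} (hb0 : ∀ n, 0 ≤ b n) (hZ : 0 < Z)
    (hx : |x| ≤ Z / 2) (hB : 0 ≤ B) (hb : ∀ n, b n ≤ B * Z⁻¹ ^ n) :
    (Summable fun n => b n * |x| ^ n) ∧ ∑' n, b n * |x| ^ n ≤ 2 * B := by
  have h1 : ∀ n, b n * |x| ^ n ≤ B * (1 / 2) ^ n := fun n => by
    calc b n * |x| ^ n ≤ B * Z⁻¹ ^ n * |x| ^ n := by gcongr; exact hb n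
      _ = B * (Z⁻¹ ^ n * |x| ^ n) := by ring
      _ ≤ _ := by gcongr; exact pow_mul_inv_pow_le hZ hx n
  have h2 : Summable fun n : ℕ => B * (1 / 2 : ℝ) ^ n := summable_geometric_two.mul_left B
  have h3 : Summable fun n => b n * |x| ^ n :=
    h2.of_nonneg_of_le (fun n => mul_nonneg (hb0 n) (by positivity)) h1
  refine ⟨h3, (h3.tsum_le_tsum h1 h2).trans ?_⟩
  rw [tsum_mul_left, tsum_geometric_two, mul_comm]

lemma abs_tsum_le_of_bound (hM : 0 ≤ M) (hA : 0 ≤ A) (hZ : 0 < Z) (hΛ : 0 ≤ Λ)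
    (h : ∀ n, ContDiff ℝ (⊤ : ℕ∞) (a n) ∧ ∀ k, ∀ t ∈ I,
      (n ! : ℝ) * |iteratedDeriv k (a n) t| ≤
        γ ^ k * ((n + k)! * primitiveWeight M A Z Λ (n + k)))
    (ht : t ∈ I) (hx : |x| ≤ Z / 2) :
    |∑' n, a n t * x ^ n| ≤ 2 * (M + Z * A * Real.exp Λ) := by
  have h1 := tsum_le_two_mul_of_le (b := fun n => |a n t|) (fun n => abs_nonneg _) hZ hx
    (by positivity) fun n =>
      (abs_coeff_le_of_bound h n ht).trans (primitiveWeight_le hM hA hZ hΛ n)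
  have h2 : ∀ n, |a n t| * |x| ^ n = ‖a n t * x ^ n‖ := fun n => by simp
  simp only [h2] at h1
  exact (norm_tsum_le_tsum_norm h1.1).trans h1.2

lemma IsFormalSolution.deriv_add_deriv_deriv (hs : IsFormalSolution q g a)
    (hM : 0 ≤ M) (hA : 0 ≤ A) (hZ : 0 < Z) (hΛ : 0 ≤ Λ) (hγ : 0 ≤ γ)
    (h : ∀ n, ContDiff ℝ (⊤ : ℕ∞) (a n) ∧ ∀ k, ∀ t ∈ I,
      (n ! : ℝ) * |iteratedDeriv k (a n) t| ≤
        γ ^ k * ((n + k)! * primitiveWeight M A Z Λ (n + k)))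
    (hI : IsOpen I) (hIc : Convex ℝ I) {Q : ℝ → ℝ} {R K : ℝ} (hqK : ∀ m, |q m| * R ^ m ≤ K)
    (hQ : ∀ y, |y| < R → HasSum (fun m => q m * y ^ m) (Q y))
    (hR : 2 * (A * Real.exp Λ) < R) (ht : t ∈ I) (hx : |x| ≤ Z / 2) :
    deriv (fun τ => ∑' n, a n τ * x ^ n) t +
        deriv (deriv (fun y => ∑' n, a n t * y ^ n)) x =
      Q (deriv (fun y => ∑' n, a n t * y ^ n) x) := by
  have hsm : SmoothCoeffs Z I a := SmoothCoeffs.of_bound hM hA hZ hΛ hγ h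
  have hxZ : |x| < Z := by linarith
  have hB : 0 ≤ A * Real.exp Λ := by positivity
  have hR0 : 0 < R := by linarith
  have hv : ∀ n, PowerSeries.coeff n (spaceDeriv a) t = ((n : ℝ) + 1) * a (n + 1) t := fun n => by
    simp [spaceDeriv]
  have hb := tsum_le_two_mul_of_le (b := fun n => |PowerSeries.coeff n (spaceDeriv a) t|)
    (fun n => abs_nonneg _) hZ hx hB fun n => by
      refine le_trans ?_ (weight_le hA hZ hΛ n)
      have h1 := abs_coeff_le_of_bound h (n + 1) ht
      have h2 : (0 : ℝ) < n + 1 := by positivity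
      rw [primitiveWeight, le_div_iff₀ h2] at h1
      rw [hv, abs_mul, abs_of_pos h2, mul_comm]
      exact h1
  have hqs : Summable fun m => |q m| * (2 * (A * Real.exp Λ)) ^ m := by
    have h1 : Summable fun m : ℕ => K * (2 * (A * Real.exp Λ) / R) ^ m :=
      (summable_geometric_of_lt_one (by positivity) ((div_lt_one hR0).2 hR)).mul_left K
    refine h1.of_nonneg_of_le (fun m => by positivity) fun m => ?_
    calc _ = |q m| * R ^ m * (2 * (A * Real.exp Λ) / R) ^ m := by
          rw [div_pow]; field_simp
      _ ≤ _ := by gcongr; exact hqK m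
  have hcomp := tsum_compCoeff hb.1 (by rw [hv]; simp [hs.one]) hb.2 hqs
  rw [hsm.deriv_time hI hIc hxZ ht, hsm.deriv_deriv_space hI hIc hxZ ht,
    hsm.deriv_space hI hIc hxZ ht, ← (hsm.deriv_coeff.summable hxZ ht).tsum_add
      (hsm.shift.shift.summable hxZ ht |>.congr fun n => by push_cast; ring)]
  have h2 : ∀ n : ℕ, deriv (a n) t * x ^ n + ((n : ℝ) + 1) * (((n : ℝ) + 2) * a (n + 2) t) * x ^ n =
      compCoeff q (spaceDeriv a) n t * x ^ n := fun n => by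
    rw [hs.add_two n]
    have h1 : ((n : ℝ) + 1) ≠ 0 := by positivity
    have h2 : ((n : ℝ) + 2) ≠ 0 := by positivity
    field_simp
    ring
  rw [tsum_congr h2, hcomp]
  simp only [hv]
  refine (hQ _ ?_).tsum_eq
  refine lt_of_le_of_lt ?_ hR
  have h3 : ∀ n, |PowerSeries.coeff n (spaceDeriv a) t| * |x| ^ n =
      ‖((n : ℝ) + 1) * a (n + 1) t * x ^ n‖ := fun n => by
    rw [hv, norm_mul, norm_pow, Real.norm_eq_abs, Real.norm_eq_abs]
  simp only [h3] at hb
  exact (norm_tsum_le_tsum_norm hb.1).trans hb.2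

end FormalSolution

lemma sum_abs_mul_pow_le {q : ℕ → ℝ} {R K ε : ℝ} (hR : 0 < R) (hK : 0 ≤ K) (hq1 : q 1 = 0)
    (hqK : ∀ m, |q m| * R ^ m ≤ K) (hε : 0 ≤ ε) (hεR : ε ≤ R / 2) (n : ℕ) :
    ∑ m ∈ Finset.range n, |q (m + 1)| * ε ^ m ≤ 2 * K * ε / R ^ 2 := by
  cases n with
  | zero => simp; positivity
  | succ n =>
    rw [Finset.sum_range_succ', zero_add, hq1, abs_zero, zero_mul, add_zero]
    have h1 : ∀ m, |q (m + 1 + 1)| * ε ^ (m + 1) ≤ K * ε / R ^ 2 * (1 / 2) ^ m := fun m => by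
      have h2 : (ε / R) ^ m ≤ (1 / 2) ^ m :=
        pow_le_pow_left₀ (by positivity) (by rw [div_le_iff₀ hR]; linarith) m
      calc |q (m + 1 + 1)| * ε ^ (m + 1)
          = |q (m + 2)| * R ^ (m + 2) * (ε / R ^ 2 * (ε / R) ^ m) := by
            rw [div_pow]; field_simp; ring
        _ ≤ K * (ε / R ^ 2 * (1 / 2) ^ m) := by gcongr; exact hqK _
        _ = _ := by ring
    calc _ ≤ ∑ m ∈ Finset.range n, K * ε / R ^ 2 * (1 / 2) ^ m := Finset.sum_le_sum fun m _ => h1 m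
      _ = K * ε / R ^ 2 * ∑ m ∈ Finset.range n, (1 / 2 : ℝ) ^ m := (Finset.mul_sum ..).symm
      _ ≤ K * ε / R ^ 2 * 2 := by
        gcongr
        exact (Summable.sum_le_tsum _ (fun _ _ => by positivity) summable_geometric_two).trans_eq
          tsum_geometric_two
      _ = _ := by ring

lemma succ_pow_three_le (k : ℕ) : (k + 1) ^ 3 ≤ 4 * 2 ^ (k + 1) := by
  match k with
  | 0 => norm_num
  | 1 => norm_num
  | 2 => norm_num
  | 3 => norm_num
  | k + 4 =>
    have h : ∀ k, (k + 5) ^ 3 ≤ 4 * 2 ^ (k + 5) := by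
      intro k
      induction k with
      | zero => norm_num
      | succ k ih =>
        rw [pow_succ 2]
        nlinarith [Nat.zero_le (k ^ 3), Nat.zero_le (k ^ 2)]
    exact h k

lemma pow_mul_le_primitiveWeight {M s Z Λ : ℝ} (hM : 0 ≤ M) (hs : 0 < s) (hZ : 0 < Z)
    (hΛ : 0 ≤ Λ) (k : ℕ) :
    M * (8 / s) ^ k ≤ (16 * Z / s) ^ k * primitiveWeight M (4 * M / Z) Z Λ k := by
  cases k with
  | zero => simp [primitiveWeight]
  | succ k =>
    have h1 := le_weight (A := 4 * M / Z) (by positivity) hZ hΛ k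
    have h2 : ((k : ℝ) + 1) ^ 3 ≤ 4 * 2 ^ (k + 1) := by exact_mod_cast succ_pow_three_le k
    have h3 : (0 : ℝ) < k + 1 := by positivity
    calc M * (8 / s) ^ (k + 1)
        = M * (8 / s) ^ (k + 1) * 1 := by ring
      _ ≤ M * (8 / s) ^ (k + 1) * (4 * 2 ^ (k + 1) / ((k : ℝ) + 1) ^ 3) := by
        gcongr
        rwa [one_le_div (by positivity)]
      _ = (16 * Z / s) ^ (k + 1) * (4 * M / Z * Z⁻¹ ^ k * ((k : ℝ) + 1)⁻¹ ^ 2 / (k + 1)) := by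
        rw [show 16 * Z / s = 2 * (8 / s) * Z by ring, mul_pow, mul_pow, pow_succ Z, inv_pow]
        field_simp
      _ ≤ _ := by
        rw [primitiveWeight]; gcongr

lemma exp_neg_inv_le_self {y : ℝ} (hy : 0 < y) : Real.exp (-y⁻¹) ≤ y := by
  rw [Real.exp_neg]
  refine inv_le_of_inv_le₀ hy ?_
  linarith [Real.add_one_le_exp y⁻¹]

lemma ten_mul_exp_le {s : ℝ} (hs : 0 < s) (hs1 : s ≤ 1 / 20) :
    10 * Real.exp (-1 / (10 * s ^ 2)) ≤ Real.exp (-(1 / 20) / s ^ 2) := by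
  have h1 : -1 / (10 * s ^ 2) = -(1 / 20) / s ^ 2 + -(20 * s ^ 2)⁻¹ := by
    field_simp; norm_num
  have h2 := exp_neg_inv_le_self (y := 20 * s ^ 2) (by positivity)
  rw [h1, Real.exp_add]
  have h3 : 20 * s ^ 2 ≤ 1 / 20 := by nlinarith
  nlinarith [Real.exp_pos (-(1 / 20) / s ^ 2)]

/-- Near every small time `s`, the formal solution with flat time profile is bounded by a convergent
majorant, with constants small enough for `Q` to be summable along it. -/
lemma IsFormalSolution.exists_local_bound {q : ℕ → ℝ} {a : ℕ → ℝ → ℝ}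
    (ha : IsFormalSolution q (fun t => expNegInvGlue (t ^ 2)) a)
    {R K s : ℝ} (hR : 0 < R) (hK : 0 < K) (hq0 : q 0 = 0) (hq1 : q 1 = 0)
    (hqK : ∀ m, |q m| * R ^ m ≤ K) (hs : 0 < s) (hs1 : s ≤ 1 / 20)
    (hsR : 12000 * s ≤ R / 2) (hsK : 12000 * s ≤ R ^ 2 / (6 * K)) :
    ∃ M A Z Λ γ : ℝ, 0 ≤ M ∧ 0 ≤ A ∧ 0 < Z ∧ 0 ≤ Λ ∧ 0 ≤ γ ∧
      (∀ n, ContDiff ℝ (⊤ : ℕ∞) (a n) ∧ ∀ k, ∀ t ∈ Metric.ball s (s / 8),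
        (n ! : ℝ) * |iteratedDeriv k (a n) t| ≤
          γ ^ k * ((n + k)! * primitiveWeight M A Z Λ (n + k))) ∧
      2 * (A * Real.exp Λ) < R ∧
      2 * (M + Z * A * Real.exp Λ) ≤ Real.exp (-(1 / 20) / s ^ 2) ∧
      ∀ x : ℝ, x ^ 2 ≤ 1 / 5120 / s → |x| ≤ Z / 2 := by
  obtain ⟨Z, hZ, hZ2⟩ : ∃ Z : ℝ, 0 < Z ∧ Z ^ 2 = 1 / (1280 * s) :=
    ⟨√(1 / (1280 * s)), by positivity, Real.sq_sqrt (by positivity)⟩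
  set E := Real.exp (-1 / (10 * s ^ 2)) with hE
  set M := Real.exp (-1 / (5 * s ^ 2)) with hM
  set Λ := 1 / (10 * s ^ 2) with hΛ
  have hME : M * Real.exp Λ = E := by
    rw [hM, hΛ, hE, ← Real.exp_add]; congr 1; field_simp; norm_num
  have hE0 : 0 < E := Real.exp_pos _
  have hM0 : 0 < M := Real.exp_pos _
  have hΛ0 : 0 < Λ := by positivity
  have hMle : M ≤ E := by
    rw [← hME]; exact le_mul_of_one_le_right hM0.le (Real.one_le_exp hΛ0.le)
  have hAE : 4 * M / Z * Real.exp Λ = 4 * E / Z := by rw [← hME]; ring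
  have hZ36 : 1 / 36 ≤ Z := by
    refine le_of_sq_le_sq ?_ hZ.le
    rw [hZ2, div_pow, div_le_div_iff₀ (by norm_num) (by positivity)]
    linarith
  have hEs : E ≤ 10 * s ^ 2 := by
    have := exp_neg_inv_le_self (y := 10 * s ^ 2) (by positivity)
    rwa [← one_div, ← neg_div] at this
  have hε : 8 * (4 * M / Z) * Real.exp Λ ≤ 12000 * s := by
    rw [mul_assoc, hAE, ← mul_div_assoc, div_le_iff₀ hZ]
    nlinarith
  have hγ : 4 / 9 ≤ 16 * Z / s := by
    rw [le_div_iff₀ hs]; linarith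
  have hA0 : 0 < 4 * M / Z := by positivity
  have hbound : ∀ n, ∑ m ∈ Finset.range n,
      |q (m + 1)| * (8 * (4 * M / Z) * Real.exp Λ) ^ m ≤ 16 * Z / s := by
    intro n
    refine (sum_abs_mul_pow_le hR hK.le hq1 hqK (by positivity) (hε.trans hsR) n).trans ?_
    refine le_trans ?_ hγ
    have h1 := hε.trans hsK
    rw [le_div_iff₀ (by positivity)] at h1
    rw [div_le_iff₀ (by positivity)]
    nlinarith [sq_nonneg R]
  refine ⟨M, 4 * M / Z, Z, Λ, 16 * Z / s, hM0.le, hA0.le, hZ, hΛ0.le, by positivity,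
    ha.bound hA0.le hZ (by positivity) ?_ hq0 hbound ?_ ?_, ?_, ?_, ?_⟩
  · have : 8 * (16 * Z / s) * Z = 128 * Z ^ 2 / s := by ring
    rw [this, hZ2, hΛ]
    apply le_of_eq
    field_simp
    norm_num
  · exact expNegInvGlue.contDiff.comp (contDiff_id.pow 2)
  · intro k t ht
    refine (abs_iteratedDeriv_expNegInvGlue_sq_le hs (by
      simpa [Real.dist_eq] using (Metric.mem_ball.1 ht).le) k).trans ?_
    have := pow_mul_le_primitiveWeight hM0.le hs hZ hΛ0.le k
    calc _ = (k ! : ℝ) * (M * (8 / s) ^ k) := by rw [mul_assoc]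
      _ ≤ (k ! : ℝ) * ((16 * Z / s) ^ k * primitiveWeight M (4 * M / Z) Z Λ k) := by gcongr
      _ = _ := by ring
  · have : 0 < 4 * M / Z * Real.exp Λ := by positivity
    linarith
  · rw [mul_assoc, hAE, mul_div_cancel₀ _ hZ.ne']
    linarith [ten_mul_exp_le hs hs1]
  · intro x hx
    refine abs_le_of_sq_le_sq ?_ (by positivity)
    rw [div_pow, hZ2]
    refine hx.trans (le_of_eq ?_)
    field_simp
    norm_num

/-- Tikhonov-type counterexample for the backward nonlinear heat equation with gradient
nonlinearity `(∂ₜ + ∂ₓₓ)u = Q(∂ₓu)`, for any `Q` real-analytic at `0` with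
`Q(0) = Q'(0) = 0`: a nontrivial local solution on `{0 < t ≤ T, x² ≤ c/t}` with
`u(0,t) = e^{-1/t²}` and `|u(x,t)| ≤ e^{-δ/t²}`. -/
theorem tikhonov_gradient_counterexample (Q : ℝ → ℝ)
    (hQan : AnalyticAt ℝ Q 0) (hQ0 : Q 0 = 0) (hQ'0 : deriv Q 0 = 0) :
    ∃ (T c δ : ℝ) (u : ℝ → ℝ → ℝ),
      0 < T ∧ T ≤ 1 ∧ 0 < c ∧ 0 < δ ∧
      ContDiffOn ℝ (⊤ : ℕ∞) (fun p : ℝ × ℝ => u p.1 p.2)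
        {p : ℝ × ℝ | 0 < p.2 ∧ p.2 ≤ T ∧ p.1 ^ 2 ≤ c / p.2} ∧
      (∀ x t : ℝ, 0 < t → t ≤ T → x ^ 2 ≤ c / t →
        deriv (fun τ => u x τ) t + deriv (deriv (fun y => u y t)) x =
          Q (deriv (fun y => u y t) x)) ∧
      (∀ t : ℝ, 0 < t → t ≤ T → u 0 t = Real.exp (-1 / t ^ 2)) ∧
      (∀ x t : ℝ, 0 < t → t ≤ T → x ^ 2 ≤ c / t →
        |u x t| ≤ Real.exp (-δ / t ^ 2)) := by
  obtain ⟨q, R, K, hR, hK, hq0, hq1, hqK, hQs⟩ := hQan.exists_hasSum_of_deriv_eq_zero hQ0 hQ'0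
  obtain ⟨a, ha⟩ := exists_isFormalSolution q (fun t => expNegInvGlue (t ^ 2))
  obtain ⟨T, hT0, hT⟩ : ∃ T : ℝ, 0 < T ∧ T ≤ 1 / 20 ∧ 12000 * T ≤ R / 2 ∧
      12000 * T ≤ R ^ 2 / (6 * K) := by
    refine ⟨min (1 / 20) (min (R / 2) (R ^ 2 / (6 * K)) / 12000), by positivity,
      min_le_left .., ?_, ?_⟩
    · linarith [min_le_right (1 / 20) (min (R / 2) (R ^ 2 / (6 * K)) / 12000),
        min_le_left (R / 2) (R ^ 2 / (6 * K))]
    · linarith [min_le_right (1 / 20) (min (R / 2) (R ^ 2 / (6 * K)) / 12000),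
        min_le_right (R / 2) (R ^ 2 / (6 * K))]
  have hloc := fun s (hs : 0 < s) (hsT : s ≤ T) => ha.exists_local_bound hR hK hq0 hq1 hqK hs
    (hsT.trans hT.1) (by linarith) (by linarith)
  have hmem : ∀ s : ℝ, 0 < s → s ∈ Metric.ball s (s / 8) := fun s hs =>
    Metric.mem_ball_self (by positivity)
  refine ⟨T, 1 / 5120, 1 / 20, fun x t => ∑' n, a n t * x ^ n, hT0, by linarith, by norm_num,
    by norm_num, ?_, ?_, ?_, ?_⟩
  · rintro ⟨x, t⟩ ⟨ht0, htT, hx⟩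
    obtain ⟨M, A, Z, Λ, γ, hM, hA, hZ, hΛ, hγ, hb, -, -, hxZ⟩ := hloc t ht0 htT
    have hxZ' := abs_lt.1 (by linarith [hxZ x hx] : |x| < Z)
    refine ContDiffAt.contDiffWithinAt (((SmoothCoeffs.of_bound hM hA hZ hΛ hγ hb).contDiffOn
      Metric.isOpen_ball (convex_ball t _)).contDiffAt ?_)
    exact (isOpen_Ioo.prod Metric.isOpen_ball).mem_nhds ⟨hxZ', hmem t ht0⟩
  · intro x t ht0 htT hx
    obtain ⟨M, A, Z, Λ, γ, hM, hA, hZ, hΛ, hγ, hb, hAR, -, hxZ⟩ := hloc t ht0 htT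
    exact ha.deriv_add_deriv_deriv hM hA hZ hΛ hγ hb Metric.isOpen_ball (convex_ball t _) hqK hQs
      hAR (hmem t ht0) (hxZ x hx)
  · intro t ht0 _
    beta_reduce
    rw [tsum_eq_single 0 fun n hn => by simp [hn], pow_zero, mul_one, ha.zero]
    beta_reduce
    have : 0 < t ^ 2 := by positivity
    rw [expNegInvGlue, if_neg this.not_ge, neg_div, one_div]
  · intro x t ht0 htT hx
    obtain ⟨M, A, Z, Λ, γ, hM, hA, hZ, hΛ, hγ, hb, -, hle, hxZ⟩ := hloc t ht0 htT
    exact (abs_tsum_le_of_bound hM hA hZ hΛ hb (hmem t ht0) (hxZ x hx)).trans hle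
end
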